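/- arXiv:1211.4811 — 2 statements merged into one kernel-verified Lean document; each statement's English description precedes it below -/
import Mathlib

section
/- Let σ be a measure on E and τ : E × X → E a measurable random shift such that: (exvisibility consequence) for every k ≥ 1, all x_1,…,x_k ∈ E, every ξ ∈ X and every l ∈ {1,…,k}, τ(x_l, ξ + δ_{x_1} + ⋯ + δ_{x_k}) = τ(x_l, ξ); (invertibility) for every ξ, τ(·,ξ) : E → E is a bijection with measurable inverse τ^{-1}(·,ξ), jointly measurable in (x,ξ); (transport) for every ξ, the pushforward of λ under τ(·,ξ) equals σ. Then the transformed point process τ_*μ satisfies, for every n ≥ 1 and all measurable v_1,…,v_n : E → [0,∞]: ∫ ∏_{k=1}^n (∫ v_k(τ(y,ξ)) ξ(dy)) μ(dξ) = ∑_{k=1}^n ∑_{𝒫 = {P_1,…,P_k} ∈ 𝒯_n^k} ∫_{E^k} ∏_{l=1}^k ∏_{i ∈ P_l} v_i(x_l) · (∫_X ĉ((τ^{-1}(x_1,ξ),…,τ^{-1}(x_k,ξ)), ξ) μ(dξ)) σ(dx_1)⋯σ(dx_k); that is, τ_*μ has correlation functions ρ_τ(x_1,…,x_k) = ∫_X ĉ((τ^{-1}(x_1,ξ),…,τ^{-1}(x_k,ξ)),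 ξ) μ(dξ) with respect to σ, in the sense of the moment characterization. -/
open MeasureTheory Finset

/-- The compound Papangelou intensity along a tuple:
`ĉ((x_1,…,x_k), ξ) = ∏_{l=1}^k c(x_l, ξ + δ_{x_1} + ⋯ + δ_{x_{l−1}})`. -/
noncomputable def chat {E : Type*} [MeasurableSpace E] (c : E → Measure E → ENNReal)
    {k : ℕ} (x : Fin k → E) (ξ : Measure E) : ENNReal :=
  ∏ l : Fin k, c (x l) (ξ + ∑ j ∈ Finset.univ.filter (fun j => j < l), Measure.dirac (x j))

/-- A fixed enumeration of the blocks of a partition of `{1,…,n}`. -/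
noncomputable def blockOf {n : ℕ} (P : Finpartition (Finset.univ : Finset (Fin n)))
    (l : Fin P.parts.card) : Finset (Fin n) := (P.parts.equivFin.symm l : { B // B ∈ P.parts })

open ProbabilityTheory
open scoped ENNReal

section Combinatorics

variable {α : Type*} [DecidableEq α] {s : Finset α} {a : α}

lemma Finpartition.notMem_of_mem_parts (ha : a ∉ s) (P : Finpartition s) {B : Finset α}
    (hB : B ∈ P.parts) : a ∉ B :=
  fun h => ha (P.le hB h)

/-- The partition of `insert a s` obtained by adding `a` to the block `B`. -/
def Finpartition.insertIntoBlock (ha : a ∉ s) (P : Finpartition s) {B : Finset α}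
    (hB : B ∈ P.parts) : Finpartition (insert a s) :=
  Finpartition.ofExistsUnique (insert (insert a B) (P.parts.erase B))
    (by
      intro t ht
      rcases Finset.mem_insert.1 ht with rfl | ht
      · exact Finset.insert_subset_insert a (P.le hB)
      · exact (P.le (Finset.mem_of_mem_erase ht)).trans (Finset.subset_insert a s))
    (by
      intro x hx
      rcases Finset.mem_insert.1 hx with rfl | hx
      · refine ⟨insert x B, ⟨by simp, by simp⟩, ?_⟩
        rintro t ⟨ht, hxt⟩
        rcases Finset.mem_insert.1 ht with rfl | ht
        · rfl
        · exact absurd hxt (P.notMem_of_mem_parts ha (Finset.mem_of_mem_erase ht))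
      · obtain ⟨t, ht, hxt⟩ := P.exists_mem hx
        have hxa : x ≠ a := fun h => ha (h ▸ hx)
        by_cases htB : t = B
        · subst htB
          refine ⟨insert a t, ⟨by simp, by simp [hxt]⟩, ?_⟩
          rintro u ⟨hu, hxu⟩
          rcases Finset.mem_insert.1 hu with rfl | hu
          · rfl
          · exact absurd (P.eq_of_mem_parts (Finset.mem_of_mem_erase hu) ht hxu hxt)
              (Finset.ne_of_mem_erase hu)
        · refine ⟨t, ⟨by simp [htB, ht], hxt⟩, ?_⟩
          rintro u ⟨hu, hxu⟩
          rcases Finset.mem_insert.1 hu with rfl | hu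
          · exact absurd (P.eq_of_mem_parts ht hB hxt (Finset.mem_of_mem_insert_of_ne hxu hxa)) htB
          · exact P.eq_of_mem_parts (Finset.mem_of_mem_erase hu) ht hxu hxt)
    (by
      intro h
      rcases Finset.mem_insert.1 h with h | h
      · exact Finset.insert_ne_empty _ _ h.symm
      · exact P.bot_notMem (Finset.mem_of_mem_erase h))

/-- The partition of `insert a s` with the additional block `{a}`. -/
def Finpartition.insertSingleton (ha : a ∉ s) (P : Finpartition s) :
    Finpartition (insert a s) :=
  P.extend (b := {a}) (Finset.singleton_ne_empty a) (Finset.disjoint_singleton_right.2 ha)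
    (by ext; simp)

/-- The partition of `insert a s` determined by a partition of `s` and an optional block
receiving `a`. -/
def Finpartition.insertElement (ha : a ∉ s) :
    (Σ P : Finpartition s, Option P.parts) → Finpartition (insert a s)
  | ⟨P, none⟩ => P.insertSingleton ha
  | ⟨P, some B⟩ => P.insertIntoBlock ha B.2

lemma Finpartition.insertElement_parts_erase (ha : a ∉ s)
    (x : Σ P : Finpartition s, Option P.parts) :
    ((Finpartition.insertElement ha x).parts.image (·.erase a)).erase ∅ = x.1.parts := by
  obtain ⟨P, B⟩ := x
  have hP : ∀ t ∈ P.parts, t.erase a = t := fun t ht =>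
    Finset.erase_eq_of_notMem (P.notMem_of_mem_parts ha ht)
  have h0 : ∅ ∉ P.parts := P.bot_notMem
  rcases B with _ | ⟨B, hB⟩
  · change ((insert {a} P.parts).image (·.erase a)).erase ∅ = P.parts
    rw [Finset.image_insert, Finset.image_congr (g := id) hP, Finset.image_id]
    simp [h0]
  · change ((insert (insert a B) (P.parts.erase B)).image (·.erase a)).erase ∅ = P.parts
    rw [Finset.image_insert, Finset.image_congr (g := id)
      (fun t ht => hP t (Finset.mem_of_mem_erase ht)), Finset.image_id,
      Finset.erase_insert (P.notMem_of_mem_parts ha hB), Finset.insert_erase hB,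
      Finset.erase_eq_of_notMem h0]

lemma Finpartition.insertElement_bijective (ha : a ∉ s) :
    Function.Bijective (Finpartition.insertElement (s := s) ha) := by
  constructor
  · intro x y hxy
    have h1 := Finpartition.insertElement_parts_erase ha x
    rw [hxy, Finpartition.insertElement_parts_erase ha y] at h1
    obtain ⟨P, B⟩ := x
    obtain ⟨P', B'⟩ := y
    obtain rfl : P' = P := Finpartition.ext h1
    have hnot : ∀ t : Finset α, insert a t ∉ P'.parts := fun t ht =>
      P'.notMem_of_mem_parts ha ht (Finset.mem_insert_self a t)
    have hparts := congrArg Finpartition.parts hxy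
    have hne : ∀ B ∈ P'.parts,
        insert {a} P'.parts ≠ insert (insert a B) (P'.parts.erase B) := by
      intro B hB h
      have h2 : {a} ∈ insert (insert a B) (P'.parts.erase B) := h ▸ Finset.mem_insert_self _ _
      rcases Finset.mem_insert.1 h2 with h2 | h2
      · have haB := P'.notMem_of_mem_parts ha hB
        have : B = ∅ := by
          rw [← Finset.erase_insert haB, ← h2]
          simp
        exact P'.ne_empty hB this
      · exact hnot ∅ (Finset.mem_of_mem_erase h2)
    rcases B with _ | ⟨B, hB⟩ <;> rcases B' with _ | ⟨B', hB'⟩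
    · rfl
    · exact absurd hparts (hne B' hB')
    · exact absurd hparts.symm (hne B hB)
    · change insert (insert a B) (P'.parts.erase B) =
        insert (insert a B') (P'.parts.erase B') at hparts
      have h2 : insert a B ∈ insert (insert a B') (P'.parts.erase B') :=
        hparts ▸ Finset.mem_insert_self _ _
      rcases Finset.mem_insert.1 h2 with h2 | h2
      · obtain rfl : B = B' := by
          rw [← Finset.erase_insert (P'.notMem_of_mem_parts ha hB), h2,
            Finset.erase_insert (P'.notMem_of_mem_parts ha hB')]
        rfl
      · exact absurd (Finset.mem_of_mem_erase h2) (hnot B)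
  · intro Q
    have hs : insert a s \ {a} = s := by
      rw [Finset.sdiff_singleton_eq_erase, Finset.erase_insert ha]
    let P : Finpartition s := (Q.avoid {a}).copy hs
    have hP : ∀ t, t ∈ P.parts ↔ ∃ d ∈ Q.parts, ¬ d ≤ {a} ∧ d \ {a} = t := fun t =>
      Q.mem_avoid
    obtain ⟨B, hB, haB⟩ := Q.exists_mem (Finset.mem_insert_self a s)
    have hother : ∀ t ∈ Q.parts, t ≠ B → t ∈ P.parts := by
      intro t ht htB
      have hat : a ∉ t := fun h => htB (Q.eq_of_mem_parts ht hB h haB)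
      refine (hP t).2 ⟨t, ht, fun hle => ?_, by
        rw [Finset.sdiff_singleton_eq_erase, Finset.erase_eq_of_notMem hat]⟩
      rcases Finset.subset_singleton_iff.1 hle with rfl | rfl
      · exact Q.bot_notMem ht
      · simp at hat
    have hback : ∀ t ∈ P.parts, t = B.erase a ∨ (t ∈ Q.parts ∧ t ≠ B) := by
      intro t ht
      obtain ⟨d, hd, -, rfl⟩ := (hP t).1 ht
      by_cases hdB : d = B
      · left; rw [hdB, Finset.sdiff_singleton_eq_erase]
      · have had : a ∉ d := fun h => hdB (Q.eq_of_mem_parts hd hB h haB)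
        rw [Finset.sdiff_singleton_eq_erase, Finset.erase_eq_of_notMem had]
        exact Or.inr ⟨hd, hdB⟩
    by_cases hBa : B = {a}
    · refine ⟨⟨P, none⟩, Finpartition.ext ?_⟩
      change insert {a} P.parts = Q.parts
      ext t
      rw [Finset.mem_insert]
      constructor
      · rintro (rfl | ht)
        · exact hBa ▸ hB
        · rcases hback t ht with rfl | ht'
          · rw [hBa] at ht
            simp only [Finset.erase_singleton] at ht
            exact absurd ht P.bot_notMem
          · exact ht'.1
      · intro ht
        by_cases htB : t = B
        · exact Or.inl (htB.trans hBa)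
        · exact Or.inr (hother t ht htB)
    · have hBP : B.erase a ∈ P.parts := by
        refine (hP _).2 ⟨B, hB, fun hle => ?_, Finset.sdiff_singleton_eq_erase a B⟩
        rcases Finset.subset_singleton_iff.1 hle with rfl | h
        · simp at haB
        · exact hBa h
      refine ⟨⟨P, some ⟨B.erase a, hBP⟩⟩, Finpartition.ext ?_⟩
      change insert (insert a (B.erase a)) (P.parts.erase (B.erase a)) = Q.parts
      rw [Finset.insert_erase haB]
      ext t
      rw [Finset.mem_insert, Finset.mem_erase]
      constructor
      · rintro (rfl | ⟨hne, ht⟩)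
        · exact hB
        · exact ((hback t ht).resolve_left hne).1
      · intro ht
        by_cases htB : t = B
        · exact Or.inl htB
        · refine Or.inr ⟨?_, hother t ht htB⟩
          rintro rfl
          obtain ⟨x, hx⟩ := Q.nonempty_of_mem_parts ht
          exact htB (Q.eq_of_mem_parts ht hB hx (Finset.mem_of_mem_erase hx))

/-- Sums over partitions of `insert a s` in terms of partitions of `s`. -/
lemma Finpartition.sum_insert {M : Type*} [AddCommMonoid M] (ha : a ∉ s)
    (g : Finset (Finset α) → M) :
    ∑ Q : Finpartition (insert a s), g Q.parts = ∑ P : Finpartition s,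
      (g (insert {a} P.parts) + ∑ B ∈ P.parts, g (insert (insert a B) (P.parts.erase B))) := by
  rw [← (Finpartition.insertElement_bijective ha).sum_comp fun Q => g Q.parts,
    Fintype.sum_sigma]
  refine Finset.sum_congr rfl fun P _ => ?_
  rw [Fintype.sum_option]
  congr 1
  exact Finset.sum_coe_sort P.parts fun B => g (insert (insert a B) (P.parts.erase B))

end Combinatorics

section Papangelou

variable {E : Type*} [MeasurableSpace E]

/-- Adding a particle at `p.2` to the configuration `p.1`. -/
noncomputable def addDirac (p : Measure E × E) : Measure E := p.1 + Measure.dirac p.2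

/-- Functions of a configuration and a point that ignore added particles. -/
def IsDiracInvariant (f : Measure E × E → ℝ≥0∞) : Prop :=
  ∀ (ξ : Measure E) (x y : E), f (ξ + Measure.dirac x, y) = f (ξ, y)

/-- The pairs `(ξ, x)` such that `x` lies in one of the sets `A n` of finite `ξ`-mass. -/
def finiteRegion (A : ℕ → Set E) : Set (Measure E × E) :=
  ⋃ n, {p | p.2 ∈ A n ∧ p.1 (A n) < ∞}

/-- The Georgii–Nguyen–Zessin identity, in uncurried form. -/
structure IsPapangelou (lam : Measure E) (μ : Measure (Measure E))
    (C : Measure E × E → ℝ≥0∞) : Prop where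
  measurable : Measurable C
  lintegral_eq : ∀ w : Measure E × E → ℝ≥0∞, Measurable w →
    ∫⁻ ξ, ∫⁻ x, w (ξ, x) ∂ξ ∂μ = ∫⁻ p, w (addDirac p, p.2) * C p ∂(μ.prod lam)

/-- A sequence of measurable sets whose finite region captures, almost everywhere, every
point lying in a measurable set of finite mass. -/
structure IsMaximalCover (lam : Measure E) (μ : Measure (Measure E)) (A : ℕ → Set E) :
    Prop where
  measurable : ∀ n, MeasurableSet (A n)
  ae_mem : ∀ B, MeasurableSet B →
    ∀ᵐ p ∂(μ.prod lam), p.2 ∈ B → p.1 B < ∞ → p ∈ finiteRegion A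

lemma measurable_eval {B : Set E} (hB : MeasurableSet B) :
    Measurable fun p : Measure E × E => p.1 B :=
  (Measure.measurable_coe hB).comp measurable_fst

@[fun_prop]
lemma measurable_addDirac : Measurable (addDirac : Measure E × E → Measure E) := by
  refine Measure.measurable_of_measurable_coe _ fun B hB => ?_
  simp only [addDirac, Measure.add_apply]
  exact (measurable_eval hB).add
    (((Measure.measurable_coe hB).comp Measure.measurable_dirac).comp measurable_snd)

lemma measurableSet_finiteRegionPiece {B : Set E} (hB : MeasurableSet B) :
    MeasurableSet {p : Measure E × E | p.2 ∈ B ∧ p.1 B < ∞} :=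
  (measurable_snd hB).inter (measurableSet_lt (measurable_eval hB) measurable_const)

lemma measurableSet_finiteRegion {A : ℕ → Set E} (hA : ∀ n, MeasurableSet (A n)) :
    MeasurableSet (finiteRegion A) :=
  MeasurableSet.iUnion fun n => measurableSet_finiteRegionPiece (hA n)

lemma add_dirac_mem_finiteRegion_iff {A : ℕ → Set E} (ξ : Measure E) (x y : E) :
    (ξ + Measure.dirac x, y) ∈ finiteRegion A ↔ (ξ, y) ∈ finiteRegion A := by
  simp only [finiteRegion, Set.mem_iUnion, Set.mem_ofPred_eq, Measure.add_apply]
  simp [ENNReal.add_lt_top, measure_lt_top]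

/-- Maximal covers exist. -/
lemma exists_isMaximalCover (lam : Measure E) [SFinite lam] (μ : Measure (Measure E))
    [SFinite μ] : ∃ A : ℕ → Set E, IsMaximalCover lam μ A := by
  let ν := (μ.prod lam).toFinite
  let R : Set ℝ≥0∞ := {r | ∃ A : ℕ → Set E, (∀ n, MeasurableSet (A n)) ∧ ν (finiteRegion A) = r}
  have hR : R.Nonempty := ⟨_, fun _ => ∅, fun _ => MeasurableSet.empty, rfl⟩
  obtain ⟨u, -, hu, huR⟩ := exists_seq_tendsto_sSup hR (OrderTop.bddAbove _)
  choose D hDm hDu using huR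
  let A : ℕ → Set E := fun j => D j.unpair.1 j.unpair.2
  have hA : ∀ n, MeasurableSet (A n) := fun n => hDm _ _
  have hsub : ∀ i, finiteRegion (D i) ⊆ finiteRegion A := by
    intro i p hp
    obtain ⟨k, hk⟩ := Set.mem_iUnion.1 hp
    exact Set.mem_iUnion.2 ⟨Nat.pair i k, by simpa [A] using hk⟩
  have hle : sSup R ≤ ν (finiteRegion A) :=
    le_of_tendsto' hu fun i => (hDu i) ▸ measure_mono (hsub i)
  refine ⟨A, hA, fun B hB => ?_⟩
  let A' : ℕ → Set E := fun n => Nat.casesOn n B A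
  have hA' : ∀ n, MeasurableSet (A' n) := by rintro (_ | n); exacts [hB, hA n]
  have hsub' : finiteRegion A ⊆ finiteRegion A' := by
    intro p hp
    obtain ⟨k, hk⟩ := Set.mem_iUnion.1 hp
    exact Set.mem_iUnion.2 ⟨k + 1, hk⟩
  have hge : ν (finiteRegion A') ≤ ν (finiteRegion A) :=
    (le_sSup ⟨A', hA', rfl⟩ : _ ≤ sSup R).trans hle
  have heq := ae_eq_of_subset_of_measure_ge hsub' hge
    (measurableSet_finiteRegion hA).nullMeasurableSet (measure_ne_top _ _)
  refine (absolutelyContinuous_toFinite (μ.prod lam)).ae_le ?_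
  filter_upwards [heq] with p hp hpB hfin
  exact hp.mpr (Set.mem_iUnion.2 ⟨0, hpB, hfin⟩)

/-- The configuration `ξ` restricted to the section of the finite region at `ξ`. -/
noncomputable def finitePart (A : ℕ → Set E) (ξ : Measure E) : Measure E :=
  ξ.restrict {x | (ξ, x) ∈ finiteRegion A}

lemma measurable_measure_restrict {B : Set E} (hB : MeasurableSet B) :
    Measurable fun ξ : Measure E => ξ.restrict B := by
  refine Measure.measurable_of_measurable_coe _ fun D hD => ?_
  simp only [Measure.restrict_apply hD]
  exact Measure.measurable_coe (hD.inter hB)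

/-- The finite part is an s-finite kernel. -/
lemma exists_kernel_eq_finitePart {A : ℕ → Set E} (hA : ∀ n, MeasurableSet (A n)) :
    ∃ κ : Kernel (Measure E) E, IsSFiniteKernel κ ∧ ∀ ξ, κ ξ = finitePart A ξ := by
  classical
  let R : ℕ → Set (Measure E × E) := fun j =>
    {p | p.2 ∈ A j.unpair.1 ∧ p.1 (A j.unpair.1) ≤ j.unpair.2}
  have hR : ∀ j, MeasurableSet (R j) := fun j =>
    (measurable_snd (hA _)).inter (measurableSet_le (measurable_eval (hA _)) measurable_const)
  have hT : ∀ j, MeasurableSet (disjointed R j) := MeasurableSet.disjointed hR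
  let G : ℕ → Set (Measure E) := fun j => {ξ | ξ (A j.unpair.1) ≤ j.unpair.2}
  have hG : ∀ j, MeasurableSet (G j) := fun j =>
    measurableSet_le (Measure.measurable_coe (hA _)) measurable_const
  let κ₀ : ℕ → Kernel (Measure E) E := fun j =>
    { toFun := (G j).piecewise (fun ξ => ξ.restrict (A j.unpair.1)) (fun _ => 0)
      measurable' := (measurable_measure_restrict (hA _)).piecewise (hG j) measurable_const }
  have hκ₀ : ∀ j, IsFiniteKernel (κ₀ j) := fun j => ⟨⟨j.unpair.2, by simp, fun ξ => by
    by_cases h : ξ ∈ G j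
    · have h' : κ₀ j ξ = ξ.restrict (A j.unpair.1) := by simp [κ₀, h]
      rw [h', Measure.restrict_apply_univ]
      exact h
    · simp [κ₀, h]⟩⟩
  let T : ℕ → Measure E → E → ℝ≥0∞ := fun j ξ x => (disjointed R j).indicator 1 (ξ, x)
  have hTm : ∀ j, Measurable (Function.uncurry (T j)) := fun j =>
    measurable_one.indicator (hT j)
  have hsec : ∀ j ξ, MeasurableSet {x | (ξ, x) ∈ disjointed R j} := fun j ξ =>
    measurable_prodMk_left (hT j)
  let κ₁ : ℕ → Kernel (Measure E) E := fun j => (κ₀ j).withDensity (T j)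
  have hκ₁ : ∀ j, IsSFiniteKernel (κ₁ j) := fun j =>
    Kernel.IsSFiniteKernel.withDensity _ fun ξ x => by
      simp only [T, Set.indicator_apply]; split_ifs <;> simp
  refine ⟨Kernel.sum κ₁, inferInstance, fun ξ => ?_⟩
  have hpiece : ∀ j, κ₁ j ξ = ξ.restrict {x | (ξ, x) ∈ disjointed R j} := by
    intro j
    have h1 : T j ξ = Set.indicator {x | (ξ, x) ∈ disjointed R j} 1 := by
      ext x; simp [T, Set.indicator_apply]
    rw [Kernel.withDensity_apply _ (hTm j), h1, withDensity_indicator_one (hsec j ξ)]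
    by_cases h : ξ ∈ G j
    · have : κ₀ j ξ = ξ.restrict (A j.unpair.1) := by simp [κ₀, h]
      rw [this, Measure.restrict_restrict (hsec j ξ), Set.inter_eq_left.2]
      exact fun x hx => (disjointed_subset R j hx).1
    · have : {x | (ξ, x) ∈ disjointed R j} = ∅ :=
        Set.eq_empty_of_forall_notMem fun x hx => h (disjointed_subset R j hx).2
      simp [this]
  have hU : {x | (ξ, x) ∈ finiteRegion A} = ⋃ j, {x | (ξ, x) ∈ disjointed R j} := by
    have h2 : (⋃ j, R j) = finiteRegion A := by
      ext p
      simp only [finiteRegion, Set.mem_iUnion, R, Set.mem_ofPred_eq]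
      constructor
      · rintro ⟨j, h, h'⟩
        exact ⟨_, h, h'.trans_lt (by simp)⟩
      · rintro ⟨n, h, h'⟩
        obtain ⟨k, hk⟩ := ENNReal.exists_nat_gt h'.ne
        exact ⟨Nat.pair n k, by simpa using ⟨h, hk.le⟩⟩
    rw [← h2, ← iUnion_disjointed]
    ext x; simp
  rw [Kernel.sum_apply, finitePart, hU, Measure.restrict_iUnion _ (hsec · ξ)]
  · simp_rw [hpiece]
  · intro i j hij
    refine Set.disjoint_left.2 fun x hx hxj => ?_
    exact Set.disjoint_left.1 (disjoint_disjointed R hij) hx hxj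

/-- Two families of configurations with almost surely equal evaluations on each measurable
set cannot be told apart by a measurable function. -/
lemma ae_forall_eq_of_ae_eval_eq {α β : Type*} [MeasurableSpace α] [MeasurableSpace β]
    {P : Measure α} {Φ Ψ : α → Measure E} (h : ∀ B, MeasurableSet B → ∀ᵐ ω ∂P, Φ ω B = Ψ ω B)
    {f : Measure E × β → ℝ≥0∞} (hf : Measurable f) :
    ∀ᵐ ω ∂P, ∀ y, f (Φ ω, y) = f (Ψ ω, y) := by
  let m : MeasurableSpace (Measure E × β) :=
    { MeasurableSet' := fun U => ∀ᵐ ω ∂P, ∀ y, (Φ ω, y) ∈ U ↔ (Ψ ω, y) ∈ U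
      measurableSet_empty := by simp
      measurableSet_compl := fun U hU => by
        filter_upwards [hU] with ω hω y
        exact not_congr (hω y)
      measurableSet_iUnion := fun U hU => by
        filter_upwards [ae_all_iff.2 hU] with ω hω y
        simp only [Set.mem_iUnion]
        exact exists_congr fun i => hω i y }
  have hfst : @Measurable _ _ m _ (Prod.fst : Measure E × β → Measure E) := by
    refine @Measure.measurable_of_measurable_coe E (Measure E × β) _ m _ fun B hB => ?_
    intro V _
    change ∀ᵐ ω ∂P, ∀ _ : β, Φ ω B ∈ V ↔ Ψ ω B ∈ V
    filter_upwards [h B hB] with ω hω y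
    rw [hω]
  have hsnd : @Measurable _ _ m _ (Prod.snd : Measure E × β → β) := by
    intro V _
    exact Filter.Eventually.of_forall fun ω y => Iff.rfl
  have hle : (Prod.instMeasurableSpace : MeasurableSpace (Measure E × β)) ≤ m :=
    sup_le hfst.comap_le hsnd.comap_le
  have hlt : ∀ q : ℚ, ∀ᵐ ω ∂P, ∀ y,
      f (Φ ω, y) < (Real.toNNReal q : ℝ≥0∞) ↔ f (Ψ ω, y) < (Real.toNNReal q : ℝ≥0∞) :=
    fun q => hle _ (measurableSet_lt hf measurable_const)
  filter_upwards [ae_all_iff.2 hlt] with ω hω y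
  apply le_antisymm
  · refine le_of_not_gt fun hl => ?_
    obtain ⟨q, -, h1, h2⟩ := ENNReal.lt_iff_exists_rat_btwn.1 hl
    exact (((hω q y).2 h1).trans h2).false
  · refine le_of_not_gt fun hl => ?_
    obtain ⟨q, -, h1, h2⟩ := ENNReal.lt_iff_exists_rat_btwn.1 hl
    exact (((hω q y).1 h1).trans h2).false

variable {lam : Measure E} {μ : Measure (Measure E)} {C : Measure E × E → ℝ≥0∞}
  {A : ℕ → Set E}

/-- Off the finite region, an added particle is invisible to measurable functions. -/
lemma IsMaximalCover.ae_addDirac_eq {β : Type*} [MeasurableSpace β]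
    (hA : IsMaximalCover lam μ A)
    {f : Measure E × β → ℝ≥0∞} (hf : Measurable f) :
    ∀ᵐ p ∂(μ.prod lam), p ∉ finiteRegion A → ∀ y, f (addDirac p, y) = f (p.1, y) := by
  have hS := measurableSet_finiteRegion hA.measurable
  have := ae_forall_eq_of_ae_eval_eq (P := (μ.prod lam).restrict (finiteRegion A)ᶜ)
    (Φ := addDirac) (Ψ := Prod.fst) (fun B hB => ?_) hf
  · exact (ae_restrict_iff' hS.compl).1 this
  · rw [ae_restrict_iff' hS.compl]
    filter_upwards [hA.ae_mem B hB] with p hp hpS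
    by_cases hpB : p.2 ∈ B
    · have : p.1 B = ∞ := by
        by_contra h
        exact hpS (hp hpB (lt_top_iff_ne_top.2 h))
      simp [addDirac, this]
    · simp [addDirac, Measure.dirac_apply' _ hB, hpB]

/-- A version of the identity configuration whose integrals are measurable: off the finite
region the configuration is replaced by its intensity. -/
noncomputable def regularized (lam : Measure E) (C : Measure E × E → ℝ≥0∞) (A : ℕ → Set E)
    (ξ : Measure E) : Measure E :=
  finitePart A ξ + lam.withDensity fun x => (finiteRegion A)ᶜ.indicator C (ξ, x)

/-- The integral of a section of `f` against the regularized configuration. -/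
noncomputable def regIntegral (lam : Measure E) (C : Measure E × E → ℝ≥0∞) (A : ℕ → Set E)
    (f : Measure E × E → ℝ≥0∞) (ξ : Measure E) : ℝ≥0∞ :=
  ∫⁻ x, f (ξ, x) ∂(regularized lam C A ξ)

lemma lintegral_finitePart (hA : ∀ n, MeasurableSet (A n)) (f : Measure E × E → ℝ≥0∞)
    (ξ : Measure E) :
    ∫⁻ x, f (ξ, x) ∂(finitePart A ξ) = ∫⁻ x, (finiteRegion A).indicator f (ξ, x) ∂ξ := by
  rw [finitePart]
  exact (lintegral_indicator (measurable_prodMk_left (measurableSet_finiteRegion hA)) _).symm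

lemma measurable_lintegral_finitePart (hA : ∀ n, MeasurableSet (A n))
    {f : Measure E × E → ℝ≥0∞} (hf : Measurable f) :
    Measurable fun ξ => ∫⁻ x, f (ξ, x) ∂(finitePart A ξ) := by
  obtain ⟨κ, hκ, h⟩ := exists_kernel_eq_finitePart hA
  simp_rw [← h]
  exact hf.lintegral_kernel_prod_right'

lemma regIntegral_eq (hC : Measurable C) (hA : ∀ n, MeasurableSet (A n))
    {f : Measure E × E → ℝ≥0∞} (hf : Measurable f) (ξ : Measure E) :
    regIntegral lam C A f ξ = ∫⁻ x, f (ξ, x) ∂(finitePart A ξ) +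
      ∫⁻ x, (finiteRegion A)ᶜ.indicator C (ξ, x) * f (ξ, x) ∂lam := by
  rw [regIntegral, regularized, lintegral_add_measure,
    lintegral_withDensity_eq_lintegral_mul _ _ (by fun_prop)]
  · rfl
  · exact (hC.indicator (measurableSet_finiteRegion hA).compl).comp measurable_prodMk_left

lemma measurable_regIntegral [SFinite lam] (hC : Measurable C) (hA : ∀ n, MeasurableSet (A n))
    {f : Measure E × E → ℝ≥0∞} (hf : Measurable f) : Measurable (regIntegral lam C A f) := by
  rw [funext (regIntegral_eq (lam := lam) hC hA hf)]
  refine (measurable_lintegral_finitePart hA hf).add ?_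
  exact Measurable.lintegral_prod_right'
    ((hC.indicator (measurableSet_finiteRegion hA).compl).mul hf)

lemma IsPapangelou.lintegral_finitePart_eq [SFinite lam] (hP : IsPapangelou lam μ C)
    (hA : ∀ n, MeasurableSet (A n)) {w : Measure E × E → ℝ≥0∞} (hw : Measurable w) :
    ∫⁻ ξ, ∫⁻ x, w (ξ, x) ∂(finitePart A ξ) ∂μ
      = ∫⁻ p, (finiteRegion A).indicator C p * w (addDirac p, p.2) ∂(μ.prod lam) := by
  simp_rw [lintegral_finitePart hA]
  rw [hP.lintegral_eq _ (hw.indicator (measurableSet_finiteRegion hA))]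
  refine lintegral_congr fun p => ?_
  have := add_dirac_mem_finiteRegion_iff (A := A) p.1 p.2 p.2
  change (addDirac p, p.2) ∈ _ ↔ p ∈ _ at this
  by_cases hp : p ∈ finiteRegion A
  · rw [Set.indicator_of_mem (this.2 hp), Set.indicator_of_mem hp, mul_comm]
  · rw [Set.indicator_of_notMem (this.not.2 hp), Set.indicator_of_notMem hp, zero_mul, zero_mul]

/-- The Georgii–Nguyen–Zessin identity holds for the regularized configuration. -/
lemma IsPapangelou.lintegral_regIntegral [SFinite lam] [SFinite μ] (hP : IsPapangelou lam μ C)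
    (hA : IsMaximalCover lam μ A) {w : Measure E × E → ℝ≥0∞} (hw : Measurable w) :
    ∫⁻ ξ, regIntegral lam C A w ξ ∂μ = ∫⁻ p, C p * w (addDirac p, p.2) ∂(μ.prod lam) := by
  have hS := measurableSet_finiteRegion hA.measurable
  simp_rw [regIntegral_eq (lam := lam) hP.measurable hA.measurable hw]
  have hm : Measurable fun p => (finiteRegion A)ᶜ.indicator C p * w p :=
    (hP.measurable.indicator hS.compl).mul hw
  rw [lintegral_add_left (measurable_lintegral_finitePart hA.measurable hw),
    hP.lintegral_finitePart_eq hA.measurable hw,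
    ← lintegral_prod (fun p => (finiteRegion A)ᶜ.indicator C p * w p) hm.aemeasurable,
    ← lintegral_add_right _ hm]
  refine lintegral_congr_ae ?_
  filter_upwards [hA.ae_addDirac_eq hw] with p hp
  by_cases hpS : p ∈ finiteRegion A
  · simp [hpS]
  · simp [hpS, hp hpS]

section Products

variable [SFinite lam] [SigmaFinite μ]

lemma IsPapangelou.setLIntegral_regIntegral (hP : IsPapangelou lam μ C)
    (hA : IsMaximalCover lam μ A) {w : Measure E × E → ℝ≥0∞} (hw : Measurable w)
    {Q : Set (Measure E)} (hQ : MeasurableSet Q) :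
    ∫⁻ ξ in Q, ∫⁻ x, w (ξ, x) ∂ξ ∂μ = ∫⁻ ξ in Q, regIntegral lam C A w ξ ∂μ := by
  have hm : Measurable ((Prod.fst ⁻¹' Q).indicator w) := hw.indicator (measurable_fst hQ)
  rw [← lintegral_indicator hQ, ← lintegral_indicator hQ]
  have h1 : ∀ ξ, Q.indicator (fun ξ => ∫⁻ x, w (ξ, x) ∂ξ) ξ
      = ∫⁻ x, (Prod.fst ⁻¹' Q).indicator w (ξ, x) ∂ξ := by
    intro ξ
    by_cases h : ξ ∈ Q <;> simp [h]
  have h2 : ∀ ξ, Q.indicator (regIntegral lam C A w) ξ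
      = regIntegral lam C A ((Prod.fst ⁻¹' Q).indicator w) ξ := by
    intro ξ
    by_cases h : ξ ∈ Q <;> simp [regIntegral, h]
  simp_rw [h1, h2]
  rw [hP.lintegral_eq _ hm, hP.lintegral_regIntegral hA hm]
  simp_rw [mul_comm (C _)]

omit [SFinite lam] in
lemma regIntegral_indicator_snd (B : Set E) (hB : MeasurableSet B) (ξ : Measure E) :
    regIntegral lam C A ((Prod.snd ⁻¹' B).indicator 1) ξ = regularized lam C A ξ B := by
  rw [regIntegral]
  exact lintegral_indicator_one hB

lemma IsPapangelou.ae_regularized_eq (hP : IsPapangelou lam μ C)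
    (hA : IsMaximalCover lam μ A) (B : Set E) (hB : MeasurableSet B) :
    ∀ᵐ ξ ∂μ, regularized lam C A ξ B = ξ B := by
  have hw : Measurable ((Prod.snd ⁻¹' B).indicator (1 : Measure E × E → ℝ≥0∞)) :=
    measurable_one.indicator (measurable_snd hB)
  have := ae_eq_of_forall_setLIntegral_eq_of_sigmaFinite (μ := μ)
    (measurable_regIntegral (lam := lam) hP.measurable hA.measurable hw)
    (Measure.measurable_coe hB) (fun Q hQ _ => ?_)
  · filter_upwards [this] with ξ hξ
    rwa [regIntegral_indicator_snd B hB] at hξ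
  · rw [← hP.setLIntegral_regIntegral hA hw hQ]
    exact lintegral_congr fun ξ => lintegral_indicator_one hB

/-- A measurable function cannot distinguish a configuration from its regularization. -/
lemma IsPapangelou.ae_apply_regularized {β : Type*} [MeasurableSpace β]
    (hP : IsPapangelou lam μ C) (hA : IsMaximalCover lam μ A) {f : Measure E × β → ℝ≥0∞}
    (hf : Measurable f) :
    ∀ᵐ ξ ∂μ, ∀ y, f (regularized lam C A ξ, y) = f (ξ, y) :=
  ae_forall_eq_of_ae_eval_eq (hP.ae_regularized_eq hA) hf

/-- The regularized integral is almost surely equal to a measurable minorant of the integral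
against the configuration. -/
lemma IsPapangelou.exists_minorant (hP : IsPapangelou lam μ C)
    (hA : IsMaximalCover lam μ A) {f : Measure E × E → ℝ≥0∞} (hf : Measurable f) :
    ∃ a : Measure E → ℝ≥0∞, Measurable a ∧ (∀ ξ, a ξ ≤ ∫⁻ x, f (ξ, x) ∂ξ) ∧
      a =ᵐ[μ] regIntegral lam C A f := by
  obtain ⟨a, ha, hle, heq⟩ :=
    exists_measurable_le_forall_setLIntegral_eq (μ := μ) (fun ξ => ∫⁻ x, f (ξ, x) ∂ξ)
  refine ⟨a, ha, hle, ae_eq_of_forall_setLIntegral_eq_of_sigmaFinite ha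
    (measurable_regIntegral hP.measurable hA.measurable hf) fun Q hQ _ => ?_⟩
  rw [← heq, hP.setLIntegral_regIntegral hA hf hQ]

/-- The integral of a product of integrals against the configuration may be computed with
the regularized integrals. -/
lemma IsPapangelou.lintegral_prod_eq (hP : IsPapangelou lam μ C)
    (hA : IsMaximalCover lam μ A) {ι : Type*} (s : Finset ι)
    {f : ι → Measure E × E → ℝ≥0∞} (hf : ∀ i, Measurable (f i)) :
    ∫⁻ ξ, ∏ i ∈ s, ∫⁻ x, f i (ξ, x) ∂ξ ∂μ = ∫⁻ ξ, ∏ i ∈ s, regIntegral lam C A (f i) ξ ∂μ := by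
  apply le_antisymm
  · obtain ⟨φ, hφ, hle, heq⟩ :=
      exists_measurable_le_lintegral_eq μ (fun ξ => ∏ i ∈ s, ∫⁻ x, f i (ξ, x) ∂ξ)
    rw [heq]
    refine lintegral_mono_ae ?_
    have h1 : ∀ᵐ ξ ∂μ, ∀ _ : Unit, φ (regularized lam C A ξ) = φ ξ :=
      hP.ae_apply_regularized hA (hφ.comp measurable_fst)
    have h2 : ∀ᵐ ξ ∂μ, ∀ i ∈ s, ∀ y, f i (regularized lam C A ξ, y) = f i (ξ, y) :=
      (ae_ball_iff s.countable_toSet).2 fun i _ => hP.ae_apply_regularized hA (hf i)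
    filter_upwards [h1, h2] with ξ h1 h2
    rw [← h1 ()]
    refine (hle _).trans (Finset.prod_le_prod' fun i hi => ?_)
    simp_rw [h2 i hi]
    exact le_rfl
  · choose a ha hle heq using fun i => hP.exists_minorant hA (hf i)
    calc ∫⁻ ξ, ∏ i ∈ s, regIntegral lam C A (f i) ξ ∂μ = ∫⁻ ξ, ∏ i ∈ s, a i ξ ∂μ := by
          refine lintegral_congr_ae ?_
          filter_upwards [(ae_ball_iff s.countable_toSet).2 fun i _ => heq i] with ξ hξ
          exact (Finset.prod_congr rfl fun i hi => hξ i hi).symm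
      _ ≤ _ := lintegral_mono fun ξ => Finset.prod_le_prod' fun i _ => hle i ξ

end Products

lemma ae_prod_of_ae_fst [SFinite lam] {p : Measure E → Prop} (hp : ∀ᵐ ξ ∂μ, p ξ) :
    ∀ᵐ q ∂(μ.prod lam), p q.1 :=
  Measure.quasiMeasurePreserving_fst.ae hp

/-- Almost sure properties survive adding a particle according to the intensity. -/
lemma IsPapangelou.ae_addDirac (hP : IsPapangelou lam μ C) {p : Measure E → Prop}
    (hp : ∀ᵐ ξ ∂μ, p ξ) : ∀ᵐ q ∂(μ.prod lam), C q ≠ 0 → p (addDirac q) := by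
  let N := toMeasurable μ {ξ | ¬ p ξ}
  have hN : MeasurableSet N := measurableSet_toMeasurable _ _
  have hN0 : ∀ᵐ ξ ∂μ, ξ ∉ N :=
    measure_eq_zero_iff_ae_notMem.1 ((measure_toMeasurable _).trans (ae_iff.1 hp))
  have hw : Measurable ((Prod.fst ⁻¹' N).indicator (1 : Measure E × E → ℝ≥0∞)) :=
    measurable_one.indicator (measurable_fst hN)
  have h0 := hP.lintegral_eq _ hw
  have h1 : ∫⁻ ξ, ∫⁻ x, (Prod.fst ⁻¹' N).indicator (1 : Measure E × E → ℝ≥0∞) (ξ, x) ∂ξ ∂μ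
      = 0 := by
    rw [← lintegral_zero (μ := μ)]
    refine lintegral_congr_ae ?_
    filter_upwards [hN0] with ξ hξ
    simp [hξ]
  have hm : Measurable fun q : Measure E × E =>
      (Prod.fst ⁻¹' N).indicator (1 : Measure E × E → ℝ≥0∞) (addDirac q, q.2) * C q :=
    (hw.comp (measurable_addDirac.prodMk measurable_snd)).mul hP.measurable
  rw [h1] at h0
  filter_upwards [(lintegral_eq_zero_iff hm).1 h0.symm] with q hq hCq
  by_contra hpq
  have : addDirac q ∈ N := subset_toMeasurable _ _ hpq
  simp [this, hCq] at hq

section AddedParticle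

variable [SFinite lam] [SigmaFinite μ]

omit [SFinite lam] in
lemma regIntegral_indicator_of_disjoint (hC : Measurable C) (hA : ∀ n, MeasurableSet (A n))
    {W : Set (Measure E × E)} (hW : MeasurableSet W) (hWS : Disjoint W (finiteRegion A))
    (ξ : Measure E) :
    regIntegral lam C A (W.indicator 1) ξ = ∫⁻ x, W.indicator C (ξ, x) ∂lam := by
  rw [regIntegral_eq hC hA (measurable_one.indicator hW), lintegral_finitePart hA]
  have h1 : (finiteRegion A).indicator (W.indicator (1 : Measure E × E → ℝ≥0∞)) = 0 := by
    rw [Set.indicator_indicator, Set.inter_comm, hWS.inter_eq, Set.indicator_empty]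
    rfl
  simp only [h1, Pi.zero_apply, lintegral_zero, zero_add]
  refine lintegral_congr fun x => ?_
  by_cases hx : (ξ, x) ∈ W
  · simp [hx, Set.disjoint_left.1 hWS hx]
  · simp [hx]

lemma IsPapangelou.ae_regIntegral_eq_top_aux (hP : IsPapangelou lam μ C)
    (hA : IsMaximalCover lam μ A) {f : Measure E × E → ℝ≥0∞} (hf : Measurable f)
    {ε : ℝ≥0∞} (hε : ε ≠ 0) :
    ∀ᵐ p ∂(μ.prod lam), C p ≠ 0 → p ∉ finiteRegion A → ε < f p →
      regIntegral lam C A f p.1 = ∞ := by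
  have hS := measurableSet_finiteRegion hA.measurable
  have hb := measurable_regIntegral (lam := lam) hP.measurable hA.measurable hf
  let W : Set (Measure E × E) :=
    {p | p ∉ finiteRegion A ∧ ε < f p ∧ regIntegral lam C A f p.1 < ∞}
  have hW : MeasurableSet W := hS.compl.inter ((measurableSet_lt measurable_const hf).inter
    (measurableSet_lt (hb.comp measurable_fst) measurable_const))
  have hWS : Disjoint W (finiteRegion A) := Set.disjoint_left.2 fun p hp => hp.1
  let C' := Wᶜ.indicator C
  have hC' : Measurable C' := hP.measurable.indicator hW.compl
  have hWC : ∀ ξ, Measurable fun x => W.indicator C (ξ, x) := fun ξ =>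
    (hP.measurable.indicator hW).comp measurable_prodMk_left
  have hfin : ∀ ξ, ∫⁻ x, W.indicator C (ξ, x) ∂lam < ∞ := by
    intro ξ
    by_cases hξ : regIntegral lam C A f ξ < ∞
    · have h1 : ε * ∫⁻ x, W.indicator C (ξ, x) ∂lam ≤ regIntegral lam C A f ξ := by
        rw [regIntegral_eq hP.measurable hA.measurable hf, ← lintegral_const_mul _ (hWC ξ)]
        refine le_add_left (lintegral_mono fun x => ?_)
        by_cases hx : (ξ, x) ∈ W
        · rw [Set.indicator_of_mem hx, Set.indicator_of_mem (Set.disjoint_left.1 hWS hx), mul_comm]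
          gcongr
          exact hx.2.1.le
        · simp [hx]
      by_contra h
      rw [not_lt, top_le_iff] at h
      rw [h, ENNReal.mul_top hε, top_le_iff] at h1
      exact hξ.ne h1
    · have : ∀ x, (ξ, x) ∉ W := fun x hx => hξ hx.2.2
      simp [this]
  have heval : ∀ B, MeasurableSet B → ∀ᵐ ξ ∂μ, regularized lam C' A ξ B = ξ B := by
    intro B hB
    filter_upwards [hP.ae_regularized_eq hA B hB, Measure.ae_ae_of_ae_prod (hA.ae_mem B hB)]
      with ξ h1 h2
    have hsum : regularized lam C A ξ B
        = regularized lam C' A ξ B + ∫⁻ x in B, W.indicator C (ξ, x) ∂lam := by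
      rw [regularized, regularized, Measure.add_apply, Measure.add_apply, add_assoc,
        withDensity_apply _ hB, withDensity_apply _ hB, ← lintegral_add_right]
      · congr 1
        refine lintegral_congr fun x => ?_
        by_cases hx : (ξ, x) ∈ W
        · simp [hx, C', Set.disjoint_left.1 hWS hx]
        · by_cases hx' : (ξ, x) ∈ finiteRegion A <;> simp [hx, C', hx']
      · exact hWC ξ
    rw [← h1, hsum]
    by_cases hξB : ξ B < ∞
    · have : ∫⁻ x in B, W.indicator C (ξ, x) ∂lam = 0 := by
        rw [← lintegral_zero (μ := lam.restrict B)]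
        refine setLIntegral_congr_fun_ae hB ?_
        filter_upwards [h2] with x hx hxB
        exact Set.indicator_of_notMem (fun hxW => hxW.1 (hx hxB hξB)) _
      rw [this, add_zero]
    · rw [not_lt, top_le_iff] at hξB
      rw [h1, hξB] at hsum
      have h3 : ∫⁻ x in B, W.indicator C (ξ, x) ∂lam ≠ ∞ :=
        ((setLIntegral_le_lintegral _ _).trans_lt (hfin ξ)).ne
      rcases ENNReal.add_eq_top.1 hsum.symm with h | h
      · rw [h, top_add]
      · exact absurd h h3
  have hw : Measurable (W.indicator (1 : Measure E × E → ℝ≥0∞)) := measurable_one.indicator hW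
  obtain ⟨a, ha, hle, haeq⟩ := hP.exists_minorant hA hw
  have ha' : ∀ᵐ ξ ∂μ, ∀ _ : Unit, a (regularized lam C' A ξ) = a ξ :=
    ae_forall_eq_of_ae_eval_eq heval (ha.comp measurable_fst)
  have hzero : ∀ᵐ ξ ∂μ, ∫⁻ x, W.indicator C (ξ, x) ∂lam = 0 := by
    filter_upwards [haeq, ha', ae_forall_eq_of_ae_eval_eq heval hw] with ξ h1 h2 h3
    rw [← regIntegral_indicator_of_disjoint hP.measurable hA.measurable hW hWS, ← h1, ← h2 (),
      ← nonpos_iff_eq_zero]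
    refine (hle _).trans ?_
    simp_rw [h3]
    change regIntegral lam C' A _ ξ ≤ 0
    rw [regIntegral_indicator_of_disjoint hC' hA.measurable hW hWS]
    have : W.indicator C' = 0 := by
      simp [C', Set.indicator_indicator]
      rfl
    simp [this]
  have hzero' : ∫⁻ p, W.indicator C p ∂(μ.prod lam) = 0 := by
    rw [lintegral_prod _ (hP.measurable.indicator hW).aemeasurable, lintegral_congr_ae hzero,
      lintegral_zero]
  filter_upwards [(lintegral_eq_zero_iff (hP.measurable.indicator hW)).1 hzero'] with p hp hCp hpS hfp
  by_contra hne
  have hpW : p ∈ W := ⟨hpS, hfp, lt_top_iff_ne_top.2 hne⟩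
  rw [Set.indicator_of_mem hpW] at hp
  exact hCp hp

/-- Off the finite region, the regularized integral of a function is infinite as soon as the
function charges the added particle. -/
lemma IsPapangelou.ae_regIntegral_eq_top (hP : IsPapangelou lam μ C)
    (hA : IsMaximalCover lam μ A) {f : Measure E × E → ℝ≥0∞} (hf : Measurable f) :
    ∀ᵐ p ∂(μ.prod lam), C p ≠ 0 → p ∉ finiteRegion A → f p ≠ 0 →
      regIntegral lam C A f p.1 = ∞ := by
  have := ae_all_iff.2 fun k : ℕ => hP.ae_regIntegral_eq_top_aux hA hf
    (ε := ((k : ℝ≥0∞) + 1)⁻¹) (by simp)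
  filter_upwards [this] with p hp hCp hpS hfp
  obtain ⟨k, hk⟩ := ENNReal.exists_inv_nat_lt hfp
  refine hp k hCp hpS (lt_of_le_of_lt ?_ hk)
  gcongr
  exact le_self_add

lemma finitePart_addDirac (hA : ∀ n, MeasurableSet (A n)) {p : Measure E × E}
    (hp : p ∈ finiteRegion A) :
    finitePart A (addDirac p) = finitePart A p.1 + Measure.dirac p.2 := by
  have hS : MeasurableSet {x | (p.1, x) ∈ finiteRegion A} :=
    measurable_prodMk_left (measurableSet_finiteRegion hA)
  have h : {x | (addDirac p, x) ∈ finiteRegion A} = {x | (p.1, x) ∈ finiteRegion A} :=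
    Set.ext fun x => add_dirac_mem_finiteRegion_iff p.1 p.2 x
  rw [finitePart, finitePart, h, addDirac, Measure.restrict_add]
  congr 1
  classical
  exact (restrict_dirac' hS).trans (if_pos hp)

/-- The regularized integral of a Dirac-invariant function is additive under adding a
particle. -/
lemma IsPapangelou.ae_regIntegral_addDirac (hP : IsPapangelou lam μ C)
    (hA : IsMaximalCover lam μ A) {f : Measure E × E → ℝ≥0∞} (hf : Measurable f)
    (hfi : IsDiracInvariant f) :
    ∀ᵐ p ∂(μ.prod lam), C p ≠ 0 →
      regIntegral lam C A f (addDirac p) = regIntegral lam C A f p.1 + f p := by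
  have hS := measurableSet_finiteRegion hA.measurable
  obtain ⟨a, ha, hle, haeq⟩ := hP.exists_minorant hA hf
  have hfi' : ∀ (p : Measure E × E) y, f (addDirac p, y) = f (p.1, y) := fun p y => hfi _ _ _
  have hdirac : ∀ p : Measure E × E, ∫⁻ y, f (p.1, y) ∂(Measure.dirac p.2) = f p := fun p =>
    lintegral_dirac' p.2 (hf.of_uncurry_left (f := fun ξ y => f (ξ, y)) (x := p.1))
  have hupper : ∀ᵐ p ∂(μ.prod lam), a (addDirac p) ≤ regIntegral lam C A f p.1 + f p := by
    have h1 : ∀ᵐ p ∂(μ.prod lam), ∀ _ : Unit,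
        a (regularized lam C A p.1 + Measure.dirac p.2) = a (addDirac p) := by
      refine ae_forall_eq_of_ae_eval_eq (fun B hB => ?_) (ha.comp measurable_fst)
      filter_upwards [ae_prod_of_ae_fst (hP.ae_regularized_eq hA B hB)] with p hp
      rw [Measure.add_apply, Measure.add_apply, hp]
    filter_upwards [h1, ae_prod_of_ae_fst (hP.ae_apply_regularized hA hf)] with p h1 h2
    rw [← h1 ()]
    refine (hle _).trans_eq ?_
    simp_rw [hfi _ _ _, h2]
    rw [lintegral_add_measure, hdirac]
    rfl
  have hlower : ∀ᵐ p ∂(μ.prod lam), C p ≠ 0 → p ∈ finiteRegion A →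
      a p.1 + f p ≤ regIntegral lam C A f (addDirac p) := by
    let Z : Set (Measure E × E) := {p | C p ≠ 0} ∩ finiteRegion A
    have hZ : MeasurableSet Z :=
      (hP.measurable (measurableSet_singleton 0).compl).inter hS
    let ξ₀ : Measure E × E → Measure E := fun p => finitePart A p.1 +
      lam.withDensity fun x => (finiteRegion A)ᶜ.indicator C (addDirac p, x)
    have hξ₀ : ∀ p ∈ finiteRegion A,
        regularized lam C A (addDirac p) = ξ₀ p + Measure.dirac p.2 := by
      intro p hp
      rw [regularized, finitePart_addDirac hA.measurable hp, add_right_comm]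
    have heval : ∀ B, MeasurableSet B → ∀ᵐ p ∂((μ.prod lam).restrict Z), ξ₀ p B = p.1 B := by
      intro B hB
      rw [ae_restrict_iff' hZ]
      filter_upwards [hP.ae_addDirac (hP.ae_regularized_eq hA B hB)] with p hp hpZ
      have := hp hpZ.1
      rw [hξ₀ p hpZ.2, addDirac, Measure.add_apply, Measure.add_apply] at this
      exact (ENNReal.add_left_inj (measure_ne_top _ _)).1 this
    have h1 : ∀ᵐ p ∂((μ.prod lam).restrict Z), ∀ _ : Unit, a (ξ₀ p) = a p.1 :=
      ae_forall_eq_of_ae_eval_eq heval (ha.comp measurable_fst)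
    have h2 : ∀ᵐ p ∂((μ.prod lam).restrict Z), ∀ y, f (ξ₀ p, y) = f (p.1, y) :=
      ae_forall_eq_of_ae_eval_eq heval hf
    rw [ae_restrict_iff' hZ] at h1 h2
    filter_upwards [h1, h2] with p h1 h2 hCp hpS
    rw [← h1 ⟨hCp, hpS⟩ (), regIntegral, hξ₀ p hpS]
    simp_rw [hfi']
    rw [lintegral_add_measure, hdirac]
    gcongr
    refine (hle _).trans_eq ?_
    simp_rw [h2 ⟨hCp, hpS⟩]
  filter_upwards [hupper, hlower, hP.ae_addDirac haeq, ae_prod_of_ae_fst haeq,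
    hP.ae_regIntegral_eq_top hA hf,
    hA.ae_addDirac_eq (β := Unit) (ha.comp measurable_fst)] with p h1 h2 h3 h4 h5 h6 hCp
  refine le_antisymm (h3 hCp ▸ h1) ?_
  by_cases hpS : p ∈ finiteRegion A
  · exact h4 ▸ h2 hCp hpS
  · have h7 : a (addDirac p) = a p.1 := h6 hpS ()
    by_cases hfp : f p = 0
    · rw [hfp, add_zero, ← h3 hCp, ← h4, h7]
    · rw [← h3 hCp, h7, h4, h5 hCp hpS hfp]
      simp

end AddedParticle

/-- The configuration with both particles added, together with the two particles. -/
noncomputable def addTwo (q : (Measure E × E) × E) : Measure E × E × E :=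
  (addDirac (addDirac q.1, q.2), q.2, q.1.2)

/-- Exchange of the two particles. -/
def swapParticles (q : (Measure E × E) × E) : (Measure E × E) × E := ((q.1.1, q.2), q.1.2)

lemma measurable_swapParticles :
    Measurable (swapParticles : (Measure E × E) × E → (Measure E × E) × E) := by
  unfold swapParticles; fun_prop

lemma measurable_addTwo : Measurable (addTwo : (Measure E × E) × E → Measure E × E × E) := by
  unfold addTwo; fun_prop

lemma addTwo_swapParticles (q : (Measure E × E) × E) :
    addTwo (swapParticles q) = ((addTwo q).1, (addTwo q).2.swap) := by
  simp [addTwo, swapParticles, addDirac, add_right_comm]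

/-- Every measurable set is the preimage of a measurable set under `addTwo`. -/
lemma exists_preimage_addTwo {Q : Set ((Measure E × E) × E)} (hQ : MeasurableSet Q) :
    ∃ Q' : Set (Measure E × E × E), MeasurableSet Q' ∧ addTwo ⁻¹' Q' = Q := by
  let m : MeasurableSpace ((Measure E × E) × E) :=
    MeasurableSpace.comap addTwo inferInstance
  have hT : @Measurable _ _ m _ (addTwo : (Measure E × E) × E → Measure E × E × E) :=
    comap_measurable _
  have h2 : @Measurable _ _ m _ (fun q : (Measure E × E) × E => q.2) :=
    (measurable_fst.comp measurable_snd).comp hT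
  have h12 : @Measurable _ _ m _ (fun q : (Measure E × E) × E => q.1.2) :=
    (measurable_snd.comp measurable_snd).comp hT
  have h11 : @Measurable _ _ m _ (fun q : (Measure E × E) × E => q.1.1) := by
    refine @Measure.measurable_of_measurable_coe E _ _ m _ fun B hB => ?_
    have heq : (fun q : (Measure E × E) × E => q.1.1 B) =
        (fun t : Measure E × E × E =>
          t.1 B - (Measure.dirac t.2.2 B + Measure.dirac t.2.1 B)) ∘ addTwo := by
      funext q
      simp only [Function.comp, addTwo, addDirac, Measure.add_apply, add_assoc]
      rw [ENNReal.add_sub_cancel_right]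
      exact ENNReal.add_ne_top.2 ⟨measure_ne_top _ _, measure_ne_top _ _⟩
    rw [heq]
    refine Measurable.comp ?_ hT
    have hd : Measurable fun x : E => Measure.dirac x B :=
      (Measure.measurable_coe hB).comp Measure.measurable_dirac
    exact ((Measure.measurable_coe hB).comp measurable_fst).sub
      ((hd.comp (measurable_snd.comp measurable_snd)).add
        (hd.comp (measurable_fst.comp measurable_snd)))
  have hid : @Measurable _ _ m Prod.instMeasurableSpace
      (id : (Measure E × E) × E → (Measure E × E) × E) :=
    (h11.prodMk h12).prodMk h2
  exact hid hQ


lemma lintegral_swapParticles [SFinite lam] [SFinite μ] {g : (Measure E × E) × E → ℝ≥0∞}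
    (hg : Measurable g) :
    ∫⁻ q, g (swapParticles q) ∂((μ.prod lam).prod lam) = ∫⁻ q, g q ∂((μ.prod lam).prod lam) := by
  have hg' : Measurable fun q => g (swapParticles q) := hg.comp measurable_swapParticles
  rw [lintegral_prod _ hg'.aemeasurable, lintegral_prod _ hg.aemeasurable,
    lintegral_prod _ hg'.lintegral_prod_right'.aemeasurable,
    lintegral_prod _ hg.lintegral_prod_right'.aemeasurable]
  refine lintegral_congr fun ξ => ?_
  refine lintegral_lintegral_swap (f := fun x y => g ((ξ, y), x)) (Measurable.aemeasurable ?_)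
  exact hg.comp (by fun_prop)

/-- The intensity of a pair of particles in the finite region. -/
noncomputable def pairIntensity (C : Measure E × E → ℝ≥0∞) (A : ℕ → Set E)
    (q : (Measure E × E) × E) : ℝ≥0∞ :=
  (finiteRegion A).indicator C q.1 * (finiteRegion A).indicator C (addDirac q.1, q.2)

lemma measurable_pairIntensity (hC : Measurable C) (hA : ∀ n, MeasurableSet (A n)) :
    Measurable (pairIntensity C A) := by
  have h := hC.indicator (measurableSet_finiteRegion hA)
  exact (h.comp measurable_fst).mul
    (h.comp ((measurable_addDirac.comp measurable_fst).prodMk measurable_snd))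

lemma IsPapangelou.lintegral_finitePart_finitePart [SFinite lam] [SFinite μ]
    (hP : IsPapangelou lam μ C)
    (hA : ∀ n, MeasurableSet (A n)) {w : Measure E × E × E → ℝ≥0∞} (hw : Measurable w) :
    ∫⁻ ξ, ∫⁻ x, ∫⁻ y, w (ξ, x, y) ∂(finitePart A ξ) ∂(finitePart A ξ) ∂μ =
      ∫⁻ q, pairIntensity C A q * w (addTwo q) ∂((μ.prod lam).prod lam) +
        ∫⁻ p, (finiteRegion A).indicator C p * w (addDirac p, p.2, p.2) ∂(μ.prod lam) := by
  obtain ⟨κ, hκ, hκA⟩ := exists_kernel_eq_finitePart hA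
  have hCS := hP.measurable.indicator (measurableSet_finiteRegion hA)
  have hG : Measurable fun p : Measure E × E => ∫⁻ y, w (p.1, p.2, y) ∂(finitePart A p.1) := by
    simp_rw [← hκA]
    have : Measurable fun t : (Measure E × E) × E => w (t.1.1, t.1.2, t.2) :=
      hw.comp (by fun_prop)
    exact this.lintegral_kernel_prod_right' (κ := κ.comap Prod.fst measurable_fst)
  rw [hP.lintegral_finitePart_eq hA hG]
  have hdiag : Measurable fun p : Measure E × E =>
      (finiteRegion A).indicator C p * w (addDirac p, p.2, p.2) :=
    hCS.mul (hw.comp (measurable_addDirac.prodMk (measurable_snd.prodMk measurable_snd)))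
  let F : (Measure E × E) × E → ℝ≥0∞ := fun t =>
    (finiteRegion A).indicator C t.1 * w (addDirac t.1, t.1.2, t.2)
  have hF : Measurable F := (hCS.comp measurable_fst).mul (hw.comp
    ((measurable_addDirac.comp measurable_fst).prodMk (by fun_prop)))
  have hsplit : ∀ p : Measure E × E, (finiteRegion A).indicator C p *
      ∫⁻ y, w (addDirac p, p.2, y) ∂(finitePart A (addDirac p)) =
      ∫⁻ y, F (p, y) ∂(finitePart A p.1) +
        (finiteRegion A).indicator C p * w (addDirac p, p.2, p.2) := by
    intro p
    by_cases hp : p ∈ finiteRegion A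
    · have hwp : Measurable fun y => w (addDirac p, p.2, y) := hw.comp (by fun_prop)
      rw [finitePart_addDirac hA hp, lintegral_add_measure, lintegral_dirac' _ hwp, mul_add,
        ← lintegral_const_mul _ hwp]
    · simp [F, hp]
  simp only [hsplit]
  rw [lintegral_add_right _ hdiag]
  congr 1
  have hH : Measurable fun p : Measure E × E => ∫⁻ x, F ((p.1, x), p.2) ∂lam :=
    Measurable.lintegral_prod_right' (f := fun t : (Measure E × E) × E => F ((t.1.1, t.2), t.1.2))
      (hF.comp (by fun_prop))
  have hFκ : Measurable fun p : Measure E × E => ∫⁻ y, F (p, y) ∂(finitePart A p.1) := by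
    simp_rw [← hκA]
    exact hF.lintegral_kernel_prod_right' (κ := κ.comap Prod.fst measurable_fst)
  have hswap : ∀ ξ, ∫⁻ x, ∫⁻ y, F ((ξ, x), y) ∂(finitePart A ξ) ∂lam =
      ∫⁻ y, ∫⁻ x, F ((ξ, x), y) ∂lam ∂(finitePart A ξ) := by
    intro ξ
    rw [← hκA]
    refine lintegral_lintegral_swap (f := fun x y => F ((ξ, x), y)) (Measurable.aemeasurable ?_)
    exact hF.comp (by fun_prop)
  rw [lintegral_prod _ hFκ.aemeasurable]
  simp only [hswap]
  rw [hP.lintegral_finitePart_eq hA hH, lintegral_prod (fun q => pairIntensity C A q * w (addTwo q))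
    ((measurable_pairIntensity hP.measurable hA).mul (hw.comp measurable_addTwo)).aemeasurable]
  refine lintegral_congr fun p => ?_
  have hFp : Measurable fun x => F ((addDirac p, x), p.2) := hF.comp (by fun_prop)
  rw [← lintegral_const_mul _ hFp]
  refine lintegral_congr fun x => ?_
  rw [pairIntensity, mul_assoc]
  rfl

lemma pairIntensity_ne_zero {q : (Measure E × E) × E}
    (h : pairIntensity C A q ≠ 0 ∨ pairIntensity C A (swapParticles q) ≠ 0) :
    (q.1.1, q.2) ∈ finiteRegion A := by
  by_contra hq
  have h1 : (addDirac q.1, q.2) ∉ finiteRegion A :=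
    (add_dirac_mem_finiteRegion_iff q.1.1 q.1.2 q.2).not.2 hq
  simp [pairIntensity, swapParticles, hq, h1] at h

/-- The intensity of a pair of particles in the finite region is symmetric. -/
lemma IsPapangelou.ae_pairIntensity_swapParticles [SigmaFinite lam] [IsFiniteMeasure μ]
    (hP : IsPapangelou lam μ C) (hA : ∀ n, MeasurableSet (A n)) :
    ∀ᵐ q ∂((μ.prod lam).prod lam),
      pairIntensity C A q = pairIntensity C A (swapParticles q) := by
  have hJ := measurable_pairIntensity hP.measurable hA
  have hsymm : ∀ w : Measure E × E × E → ℝ≥0∞, Measurable w →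
      ∫⁻ p, (finiteRegion A).indicator C p * w (addDirac p, p.2, p.2) ∂(μ.prod lam) ≠ ∞ →
      ∫⁻ q, pairIntensity C A q * w (addTwo q) ∂((μ.prod lam).prod lam) =
        ∫⁻ q, pairIntensity C A (swapParticles q) * w (addTwo q) ∂((μ.prod lam).prod lam) := by
    intro w hw hfin
    have hw' : Measurable fun t : Measure E × E × E => w (t.1, t.2.swap) := hw.comp (by fun_prop)
    have h1 := hP.lintegral_finitePart_finitePart hA hw
    have h2 := hP.lintegral_finitePart_finitePart hA hw'
    obtain ⟨κ, hκ, hκA⟩ := exists_kernel_eq_finitePart hA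
    have h3 : ∀ ξ, ∫⁻ x, ∫⁻ y, w (ξ, x, y) ∂(finitePart A ξ) ∂(finitePart A ξ) =
        ∫⁻ x, ∫⁻ y, w (ξ, y, x) ∂(finitePart A ξ) ∂(finitePart A ξ) := by
      intro ξ
      rw [← hκA]
      exact lintegral_lintegral_swap (f := fun x y => w (ξ, x, y))
        (hw.comp (by fun_prop)).aemeasurable
    simp only [h3] at h1
    have h4 := h1.symm.trans h2
    simp only [Prod.swap_prod_mk] at h4
    rw [(ENNReal.add_left_inj hfin).1 h4, ← lintegral_swapParticles]
    · refine lintegral_congr fun q => ?_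
      simp only [addTwo_swapParticles, Prod.swap_swap, Prod.mk.eta]
    · exact hJ.mul (hw'.comp measurable_addTwo)
  let V : ℕ → ℕ → Set (Measure E × E × E) := fun n k => {t | t.2.1 ∈ A n ∧ t.1 (A n) ≤ k}
  have hV : ∀ n k, MeasurableSet (V n k) := fun n k =>
    ((measurable_fst.comp measurable_snd) (hA n)).inter
      (measurableSet_le ((Measure.measurable_coe (hA n)).comp measurable_fst) measurable_const)
  have hVfin : ∀ n k, ∫⁻ p, (finiteRegion A).indicator C p *
      (V n k).indicator 1 (addDirac p, p.2, p.2) ∂(μ.prod lam) ≠ ∞ := by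
    intro n k
    have hm : Measurable fun p : Measure E × E =>
        (V n k).indicator (1 : Measure E × E × E → ℝ≥0∞) (p.1, p.2, p.2) :=
      (measurable_one.indicator (hV n k)).comp (by fun_prop)
    have := hP.lintegral_finitePart_eq hA hm
    rw [← this]
    refine ne_top_of_le_ne_top (ENNReal.mul_ne_top (ENNReal.natCast_ne_top k)
      (measure_ne_top μ Set.univ)) ?_
    rw [← lintegral_const]
    refine lintegral_mono fun ξ => ?_
    by_cases hξ : ξ (A n) ≤ k
    · have h1 : ∀ x, (V n k).indicator (1 : Measure E × E × E → ℝ≥0∞) (ξ, x, x) =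
          (A n).indicator 1 x := by
        intro x
        by_cases hx : x ∈ A n <;> simp [V, hx, hξ]
      simp only [h1]
      rw [lintegral_indicator_one (hA n)]
      exact (Measure.restrict_apply_le _ _).trans hξ
    · have h1 : ∀ x, (V n k).indicator (1 : Measure E × E × E → ℝ≥0∞) (ξ, x, x) = 0 := by
        intro x
        simp [V, hξ]
      simp [h1]
  have hae : ∀ n k, ∀ᵐ q ∂((μ.prod lam).prod lam), addTwo q ∈ V n k →
      pairIntensity C A q = pairIntensity C A (swapParticles q) := by
    intro n k
    have hVm := measurable_addTwo (hV n k)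
    refine (ae_restrict_iff' hVm).1 (ae_eq_of_forall_setLIntegral_eq_of_sigmaFinite hJ
      (hJ.comp measurable_swapParticles) fun Q hQ _ => ?_)
    obtain ⟨Q', hQ', rfl⟩ := exists_preimage_addTwo hQ
    have hind : ∀ g : (Measure E × E) × E → ℝ≥0∞,
        ∫⁻ q in addTwo ⁻¹' Q', g q ∂(((μ.prod lam).prod lam).restrict (addTwo ⁻¹' V n k)) =
        ∫⁻ q, g q * (Q' ∩ V n k).indicator 1 (addTwo q) ∂((μ.prod lam).prod lam) := by
      intro g
      rw [Measure.restrict_restrict hQ, ← Set.preimage_inter,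
        ← lintegral_indicator (measurable_addTwo (hQ'.inter (hV n k)))]
      refine lintegral_congr fun q => ?_
      by_cases hq : addTwo q ∈ Q' ∩ V n k
      · rw [Set.indicator_of_mem (show q ∈ addTwo ⁻¹' (Q' ∩ V n k) from hq),
          Set.indicator_of_mem hq, Pi.one_apply, mul_one]
      · rw [Set.indicator_of_notMem (show q ∉ addTwo ⁻¹' (Q' ∩ V n k) from hq),
          Set.indicator_of_notMem hq, mul_zero]
    rw [hind, hind]
    refine hsymm _ (measurable_one.indicator (hQ'.inter (hV n k)))
      (ne_top_of_le_ne_top (hVfin n k) (lintegral_mono fun p => ?_))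
    gcongr
    exact Set.inter_subset_right
  filter_upwards [ae_all_iff.2 fun n => ae_all_iff.2 (hae n)] with q hq
  by_cases hqS : (q.1.1, q.2) ∈ finiteRegion A
  · obtain ⟨n, hn1, hn2⟩ := Set.mem_iUnion.1 hqS
    have hfin : (addTwo q).1 (A n) ≠ ∞ := by
      simp only [addTwo, addDirac, Measure.add_apply]
      exact ENNReal.add_ne_top.2 ⟨ENNReal.add_ne_top.2 ⟨hn2.ne, measure_ne_top _ _⟩,
        measure_ne_top _ _⟩
    obtain ⟨k, hk⟩ := ENNReal.exists_nat_gt hfin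
    exact hq n k ⟨hn1, hk.le⟩
  · have h := mt (pairIntensity_ne_zero (C := C)) hqS
    push Not at h
    rw [h.1, h.2]

/-- Integration of one added particle against the intensity, weighted by `F`. -/
noncomputable def stepIntegral (lam : Measure E) (C : Measure E × E → ℝ≥0∞)
    (F : Measure E × E → ℝ≥0∞) (G : Measure E → ℝ≥0∞) (ξ : Measure E) : ℝ≥0∞ :=
  ∫⁻ x, F (ξ, x) * C (ξ, x) * G (addDirac (ξ, x)) ∂lam

/-- Measurable functions that ignore added particles. -/
structure IsWeight (F : Measure E × E → ℝ≥0∞) : Prop where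
  measurable : Measurable F
  isDiracInvariant : IsDiracInvariant F

lemma IsWeight.apply_addDirac {F : Measure E × E → ℝ≥0∞} (hF : IsWeight F)
    (p : Measure E × E) (y : E) : F (addDirac p, y) = F (p.1, y) :=
  hF.isDiracInvariant _ _ _

lemma IsWeight.mul {F f : Measure E × E → ℝ≥0∞} (hF : IsWeight F) (hf : IsWeight f) :
    IsWeight (F * f) where
  measurable := hF.measurable.mul hf.measurable
  isDiracInvariant ξ x y := by
    simp only [Pi.mul_apply, hF.isDiracInvariant ξ x y, hf.isDiracInvariant ξ x y]

lemma IsWeight.prod {ι : Type*} (s : Finset ι) {f : ι → Measure E × E → ℝ≥0∞}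
    (hf : ∀ i, IsWeight (f i)) : IsWeight (fun p => ∏ i ∈ s, f i p) where
  measurable := Finset.measurable_fun_prod s fun i _ => (hf i).measurable
  isDiracInvariant ξ x y := Finset.prod_congr rfl fun i _ => (hf i).isDiracInvariant ξ x y

lemma IsWeight.indicator {F : Measure E × E → ℝ≥0∞} (hF : IsWeight F)
    (hA : ∀ n, MeasurableSet (A n)) : IsWeight ((finiteRegion A).indicator F) where
  measurable := hF.measurable.indicator (measurableSet_finiteRegion hA)
  isDiracInvariant ξ x y := by
    have h := add_dirac_mem_finiteRegion_iff (A := A) ξ x y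
    by_cases hy : (ξ, y) ∈ finiteRegion A
    · simp [hy, h.2 hy, hF.isDiracInvariant ξ x y]
    · simp [hy, h.not.2 hy]

lemma IsWeight.indicator_compl {F : Measure E × E → ℝ≥0∞} (hF : IsWeight F)
    (hA : ∀ n, MeasurableSet (A n)) : IsWeight ((finiteRegion A)ᶜ.indicator F) where
  measurable := hF.measurable.indicator (measurableSet_finiteRegion hA).compl
  isDiracInvariant ξ x y := by
    have h := add_dirac_mem_finiteRegion_iff (A := A) ξ x y
    by_cases hy : (ξ, y) ∈ finiteRegion A
    · simp [hy, h.2 hy]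
    · simp [hy, h.not.2 hy, hF.isDiracInvariant ξ x y]

section Step

variable {F f : Measure E × E → ℝ≥0∞} {G G' : Measure E → ℝ≥0∞}

lemma measurable_stepIntegrand (hC : Measurable C) (hF : Measurable F) (hG : Measurable G) :
    Measurable fun p : Measure E × E => F p * C p * G (addDirac p) :=
  (hF.mul hC).mul (hG.comp measurable_addDirac)

lemma measurable_stepIntegrand_section (hC : Measurable C) (hF : Measurable F)
    (hG : Measurable G) (ξ : Measure E) :
    Measurable fun x => F (ξ, x) * C (ξ, x) * G (addDirac (ξ, x)) :=
  (measurable_stepIntegrand hC hF hG).comp measurable_prodMk_left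

lemma measurable_stepIntegral [SFinite lam] (hC : Measurable C) (hF : Measurable F)
    (hG : Measurable G) : Measurable (stepIntegral lam C F G) :=
  Measurable.lintegral_prod_right' (measurable_stepIntegrand hC hF hG)

lemma stepIntegral_add_left (hC : Measurable C) (hF : Measurable F) (hG : Measurable G) :
    stepIntegral lam C (F + f) G = stepIntegral lam C F G + stepIntegral lam C f G := by
  funext ξ
  rw [Pi.add_apply, stepIntegral, stepIntegral, stepIntegral,
    ← lintegral_add_left (measurable_stepIntegrand_section hC hF hG ξ)]
  simp only [Pi.add_apply, add_mul]

lemma stepIntegral_add_right (hC : Measurable C) (hF : Measurable F) (hG : Measurable G) :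
    stepIntegral lam C F (G + G') = stepIntegral lam C F G + stepIntegral lam C F G' := by
  funext ξ
  rw [Pi.add_apply, stepIntegral, stepIntegral, stepIntegral,
    ← lintegral_add_left (measurable_stepIntegrand_section hC hF hG ξ)]
  simp only [Pi.add_apply, mul_add]

lemma stepIntegral_sum_right {ι : Type*} (s : Finset ι) {H : ι → Measure E → ℝ≥0∞}
    (hC : Measurable C) (hF : Measurable F) (hH : ∀ i, Measurable (H i)) :
    stepIntegral lam C F (∑ i ∈ s, H i) = ∑ i ∈ s, stepIntegral lam C F (H i) := by
  classical
  induction s using Finset.induction_on with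
  | empty => funext ξ; simp [stepIntegral]
  | insert i s hi ih =>
    rw [Finset.sum_insert hi, Finset.sum_insert hi, stepIntegral_add_right hC hF (hH i), ih]

/-- Integrals of one added particle agree if their integrands agree almost everywhere. -/
lemma ae_stepIntegral_eq [SFinite lam] {f : Measure E × E → ℝ≥0∞}
    (h : ∀ᵐ p ∂(μ.prod lam), F p * C p * G (addDirac p) = f p * C p * G' (addDirac p)) :
    stepIntegral lam C F G =ᵐ[μ] stepIntegral lam C f G' := by
  filter_upwards [Measure.ae_ae_of_ae_prod h] with ξ hξ
  exact lintegral_congr_ae hξ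

lemma IsPapangelou.stepIntegral_congr [SFinite lam] (hP : IsPapangelou lam μ C)
    (h : G =ᵐ[μ] G') : stepIntegral lam C F G =ᵐ[μ] stepIntegral lam C F G' := by
  refine ae_stepIntegral_eq ?_
  filter_upwards [hP.ae_addDirac h] with p hp
  by_cases hC : C p = 0
  · simp [hC]
  · rw [hp hC]

variable [SigmaFinite lam] [IsFiniteMeasure μ]

/-- The Leibniz rule for regularized integrals under integration of an added particle. -/
lemma IsPapangelou.stepIntegral_regIntegral_mul (hP : IsPapangelou lam μ C)
    (hA : IsMaximalCover lam μ A) (hF : IsWeight F) (hf : IsWeight f) (hG : Measurable G) :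
    stepIntegral lam C F (regIntegral lam C A f * G) =ᵐ[μ]
      regIntegral lam C A f * stepIntegral lam C F G + stepIntegral lam C (F * f) G := by
  filter_upwards [Measure.ae_ae_of_ae_prod
    (hP.ae_regIntegral_addDirac hA hf.measurable hf.isDiracInvariant)] with ξ hξ
  have h1 := measurable_stepIntegrand_section hP.measurable hF.measurable hG ξ
  rw [Pi.add_apply, Pi.mul_apply, stepIntegral, stepIntegral, stepIntegral,
    ← lintegral_const_mul _ h1, ← lintegral_add_left (h1.const_mul _)]
  refine lintegral_congr_ae ?_
  filter_upwards [hξ] with x hx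
  by_cases hC : C (ξ, x) = 0
  · simp [hC]
  · simp only [Pi.mul_apply, hx hC]
    ring

omit [IsFiniteMeasure μ] [SigmaFinite lam] in
/-- Off the finite region, integrating an added particle is multiplication by a regularized
integral. -/
lemma IsPapangelou.stepIntegral_compl [SFinite lam] [SFinite μ] (hP : IsPapangelou lam μ C)
    (hA : IsMaximalCover lam μ A) (hF : Measurable F) (hG : Measurable G) :
    stepIntegral lam C ((finiteRegion A)ᶜ.indicator F) G =ᵐ[μ]
      regIntegral lam C A ((finiteRegion A)ᶜ.indicator F) * G := by
  have hS := measurableSet_finiteRegion hA.measurable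
  filter_upwards [Measure.ae_ae_of_ae_prod
    (hA.ae_addDirac_eq (β := Unit) (hG.comp measurable_fst))] with ξ hξ
  have hm : Measurable fun x =>
      (finiteRegion A)ᶜ.indicator C (ξ, x) * (finiteRegion A)ᶜ.indicator F (ξ, x) :=
    ((hP.measurable.indicator hS.compl).mul (hF.indicator hS.compl)).comp measurable_prodMk_left
  rw [Pi.mul_apply, regIntegral_eq hP.measurable hA.measurable (hF.indicator hS.compl),
    lintegral_finitePart hA.measurable, stepIntegral, Set.indicator_indicator,
    Set.inter_compl_self, Set.indicator_empty]
  simp only [lintegral_zero, zero_add]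
  rw [← lintegral_mul_const _ hm]
  refine lintegral_congr_ae ?_
  filter_upwards [hξ] with x hx
  by_cases hxS : (ξ, x) ∈ finiteRegion A
  · simp [hxS]
  · have : G (addDirac (ξ, x)) = G ξ := hx hxS ()
    simp [hxS, this, mul_comm]

lemma IsPapangelou.stepIntegral_compl_comm (hP : IsPapangelou lam μ C)
    (hA : IsMaximalCover lam μ A) (hF : IsWeight F) (hf : IsWeight f) (hG : Measurable G) :
    stepIntegral lam C ((finiteRegion A)ᶜ.indicator F) (stepIntegral lam C f G) =ᵐ[μ]
      stepIntegral lam C f (stepIntegral lam C ((finiteRegion A)ᶜ.indicator F) G) := by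
  have hFc := hF.indicator_compl hA.measurable
  have hb := hP.ae_regIntegral_addDirac hA hFc.measurable hFc.isDiracInvariant
  have h1 := hP.stepIntegral_compl hA hF.measurable
    (measurable_stepIntegral (lam := lam) hP.measurable hf.measurable hG)
  have h2 := hP.stepIntegral_congr (F := f) (hP.stepIntegral_compl hA hF.measurable hG)
  have h3 : ∀ᵐ p ∂(μ.prod lam), C p ≠ 0 →
      regIntegral lam C A ((finiteRegion A)ᶜ.indicator F) (addDirac p) =
        regIntegral lam C A ((finiteRegion A)ᶜ.indicator F) p.1 := by
    filter_upwards [hb, hP.ae_regIntegral_eq_top hA hFc.measurable] with p hp hp' hCp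
    rw [hp hCp]
    by_cases h0 : (finiteRegion A)ᶜ.indicator F p = 0
    · rw [h0, add_zero]
    · rw [hp' hCp (fun hpS => h0 (by simp [hpS])) h0, top_add]
  refine h1.trans (Filter.EventuallyEq.symm (h2.trans ?_))
  filter_upwards [Measure.ae_ae_of_ae_prod h3] with ξ hξ
  have hm := measurable_stepIntegrand_section hP.measurable hf.measurable hG ξ
  rw [Pi.mul_apply, stepIntegral, stepIntegral, ← lintegral_const_mul _ hm]
  refine lintegral_congr_ae ?_
  filter_upwards [hξ] with x hx
  by_cases hC : C (ξ, x) = 0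
  · simp [hC]
  · simp only [Pi.mul_apply, hx hC]
    ring

omit [SigmaFinite lam] in
lemma stepIntegral_finiteRegion_comp (hC : Measurable C) (hA : ∀ n, MeasurableSet (A n))
    (hf : IsWeight f) (hG : Measurable G) (ξ : Measure E) :
    stepIntegral lam C ((finiteRegion A).indicator F)
      (stepIntegral lam C ((finiteRegion A).indicator f) G) ξ =
    ∫⁻ x, ∫⁻ y, F (ξ, x) * f (ξ, y) * pairIntensity C A ((ξ, x), y) *
      G (addTwo ((ξ, x), y)).1 ∂lam ∂lam := by
  rw [stepIntegral]
  refine lintegral_congr fun x => ?_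
  rw [stepIntegral, ← lintegral_const_mul _ (measurable_stepIntegrand_section hC
    (hf.indicator hA).measurable hG _)]
  refine lintegral_congr fun y => ?_
  rw [(hf.indicator hA).apply_addDirac]
  have hiff := add_dirac_mem_finiteRegion_iff (A := A) ξ x y
  change (addDirac (ξ, x), y) ∈ _ ↔ _ at hiff
  by_cases hx : (ξ, x) ∈ finiteRegion A <;> by_cases hy : (ξ, y) ∈ finiteRegion A
  · simp [pairIntensity, addTwo, hx, hy, hiff.2 hy]
    ring
  · simp [pairIntensity, addTwo, hx, hy, hiff.not.2 hy]
  · simp [pairIntensity, addTwo, hx]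
  · simp [pairIntensity, addTwo, hx]

lemma IsPapangelou.stepIntegral_finiteRegion_comm (hP : IsPapangelou lam μ C)
    (hA : ∀ n, MeasurableSet (A n)) (hF : IsWeight F) (hf : IsWeight f) (hG : Measurable G) :
    stepIntegral lam C ((finiteRegion A).indicator F)
        (stepIntegral lam C ((finiteRegion A).indicator f) G) =ᵐ[μ]
      stepIntegral lam C ((finiteRegion A).indicator f)
        (stepIntegral lam C ((finiteRegion A).indicator F) G) := by
  filter_upwards [Measure.ae_ae_of_ae_prod (Measure.ae_ae_of_ae_prod
    (hP.ae_pairIntensity_swapParticles hA))] with ξ hξ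
  rw [stepIntegral_finiteRegion_comp hP.measurable hA hf hG,
    stepIntegral_finiteRegion_comp hP.measurable hA hF hG]
  have hm : Measurable fun q : E × E => f (ξ, q.1) * F (ξ, q.2) *
      pairIntensity C A ((ξ, q.1), q.2) * G (addTwo ((ξ, q.1), q.2)).1 := by
    refine (((hf.measurable.comp (by fun_prop)).mul (hF.measurable.comp (by fun_prop))).mul
      ((measurable_pairIntensity hP.measurable hA).comp (by fun_prop))).mul
      (hG.comp (measurable_fst.comp (measurable_addTwo.comp (by fun_prop))))
  rw [lintegral_lintegral_swap (f := fun x y => f (ξ, x) * F (ξ, y) *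
    pairIntensity C A ((ξ, x), y) * G (addTwo ((ξ, x), y)).1) hm.aemeasurable]
  refine lintegral_congr_ae ?_
  filter_upwards [hξ] with x hx
  refine lintegral_congr_ae ?_
  filter_upwards [hx] with y hy
  have h1 : addTwo ((ξ, y), x) = ((addTwo ((ξ, x), y)).1, (addTwo ((ξ, x), y)).2.swap) :=
    addTwo_swapParticles ((ξ, x), y)
  rw [hy, h1, mul_comm (F (ξ, x))]
  rfl

/-- Integrations of two added particles commute. -/
lemma IsPapangelou.stepIntegral_comm (hP : IsPapangelou lam μ C)
    (hA : IsMaximalCover lam μ A) (hF : IsWeight F) (hf : IsWeight f) (hG : Measurable G) :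
    stepIntegral lam C F (stepIntegral lam C f G) =ᵐ[μ]
      stepIntegral lam C f (stepIntegral lam C F G) := by
  have hC := hP.measurable
  have hFs := hF.indicator hA.measurable
  have hFc := hF.indicator_compl hA.measurable
  have hfs := hf.indicator hA.measurable
  have hFG := measurable_stepIntegral (lam := lam) hC hFs.measurable hG
  have hfG := measurable_stepIntegral (lam := lam) hC hfs.measurable hG
  have hfG' := measurable_stepIntegral (lam := lam) hC hf.measurable hG
  have hs : stepIntegral lam C ((finiteRegion A).indicator F) (stepIntegral lam C f G) =ᵐ[μ]
      stepIntegral lam C f (stepIntegral lam C ((finiteRegion A).indicator F) G) := by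
    rw [← Set.indicator_self_add_compl (finiteRegion A) f,
      stepIntegral_add_left hC hfs.measurable hG, stepIntegral_add_left hC hfs.measurable hFG,
      stepIntegral_add_right hC hFs.measurable hfG]
    exact (hP.stepIntegral_finiteRegion_comm hA.measurable hF hf hG).add
      (hP.stepIntegral_compl_comm hA hf hFs hG).symm
  have hsum := hs.add (hP.stepIntegral_compl_comm hA hF hf hG)
  rw [← stepIntegral_add_left hC hFs.measurable hfG',
    ← stepIntegral_add_right hC hf.measurable hFG, ← stepIntegral_add_left hC hFs.measurable hG,
    Set.indicator_self_add_compl] at hsum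
  exact hsum

end Step

section Iterated

variable {β : Type*} {F : β → Measure E × E → ℝ≥0∞} {l l' : List β} {U : Measure E → ℝ≥0∞}

/-- Integration of the added particles of a list of weights. -/
noncomputable def iterIntegral (lam : Measure E) (C : Measure E × E → ℝ≥0∞)
    (F : β → Measure E × E → ℝ≥0∞) (l : List β) (U : Measure E → ℝ≥0∞) : Measure E → ℝ≥0∞ :=
  l.foldr (fun B G => stepIntegral lam C (F B) G) U

lemma iterIntegral_cons (B : β) :
    iterIntegral lam C F (B :: l) U = stepIntegral lam C (F B) (iterIntegral lam C F l U) :=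
  rfl

lemma measurable_iterIntegral [SFinite lam] (hC : Measurable C) (hF : ∀ B, Measurable (F B))
    (hU : Measurable U) : Measurable (iterIntegral lam C F l U) := by
  induction l with
  | nil => exact hU
  | cons B l ih => exact measurable_stepIntegral hC (hF B) ih

lemma IsPapangelou.iterIntegral_perm [SigmaFinite lam] [IsFiniteMeasure μ]
    (hP : IsPapangelou lam μ C) (hA : IsMaximalCover lam μ A) (hF : ∀ B, IsWeight (F B))
    (hU : Measurable U) (h : l.Perm l') :
    iterIntegral lam C F l U =ᵐ[μ] iterIntegral lam C F l' U := by
  induction h with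
  | nil => rfl
  | cons B _ ih => exact hP.stepIntegral_congr ih
  | swap B B' l =>
    exact hP.stepIntegral_comm hA (hF _) (hF _)
      (measurable_iterIntegral hP.measurable (fun B => (hF B).measurable) hU)
  | trans _ _ h1 h2 => exact h1.trans h2

end Iterated

section Blocks

variable {α : Type*} {f : α → Measure E × E → ℝ≥0∞} {a : α} {U : Measure E → ℝ≥0∞}
  {Q : Finset (Finset α)} {B : Finset α}

/-- Integration of one added particle for every block of `Q`, weighted by the product of the
weights belonging to the block. -/
noncomputable def blockIntegral (lam : Measure E) (C : Measure E × E → ℝ≥0∞)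
    (f : α → Measure E × E → ℝ≥0∞) (Q : Finset (Finset α)) (U : Measure E → ℝ≥0∞) :
    Measure E → ℝ≥0∞ :=
  iterIntegral lam C (fun B p => ∏ i ∈ B, f i p) Q.toList U

lemma measurable_blockIntegral [SFinite lam] (hC : Measurable C) (hf : ∀ i, IsWeight (f i))
    (hU : Measurable U) : Measurable (blockIntegral lam C f Q U) :=
  measurable_iterIntegral hC (fun B => (IsWeight.prod B hf).measurable) hU

variable [DecidableEq α] [SigmaFinite lam] [IsFiniteMeasure μ]

lemma IsPapangelou.blockIntegral_insert (hP : IsPapangelou lam μ C)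
    (hA : IsMaximalCover lam μ A) (hf : ∀ i, IsWeight (f i)) (hU : Measurable U) (hB : B ∉ Q) :
    blockIntegral lam C f (insert B Q) U =ᵐ[μ]
      stepIntegral lam C (fun p => ∏ i ∈ B, f i p) (blockIntegral lam C f Q U) :=
  hP.iterIntegral_perm hA (fun B => IsWeight.prod B hf) hU (Finset.toList_insert hB)

/-- The Leibniz rule for a regularized integral inside integrals over blocks. -/
lemma IsPapangelou.blockIntegral_regIntegral_mul (hP : IsPapangelou lam μ C)
    (hA : IsMaximalCover lam μ A) (hf : ∀ i, IsWeight (f i)) (hU : Measurable U)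
    (ha : ∀ B ∈ Q, a ∉ B) :
    blockIntegral lam C f Q (regIntegral lam C A (f a) * U) =ᵐ[μ]
      regIntegral lam C A (f a) * blockIntegral lam C f Q U +
        ∑ B ∈ Q, blockIntegral lam C f (insert (insert a B) (Q.erase B)) U := by
  have hC := hP.measurable
  have hbU : Measurable (regIntegral lam C A (f a) * U) :=
    (measurable_regIntegral hC hA.measurable (hf a).measurable).mul hU
  induction Q using Finset.induction_on with
  | empty => simp [blockIntegral, iterIntegral]
  | insert D Q hD ih =>
    have haD : a ∉ D := ha D (Finset.mem_insert_self D Q)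
    have ha' : ∀ B ∈ Q, a ∉ B := fun B hB => ha B (Finset.mem_insert_of_mem hB)
    have hm : ∀ R : Finset (Finset α), Measurable (blockIntegral lam C f R U) :=
      fun R => measurable_blockIntegral hC hf hU
    have hFD := IsWeight.prod D hf
    have h1 := (hP.blockIntegral_insert hA hf hbU hD).trans (hP.stepIntegral_congr (ih ha'))
    rw [stepIntegral_add_right hC hFD.measurable
      ((measurable_regIntegral hC hA.measurable (hf a).measurable).mul (hm Q)),
      stepIntegral_sum_right Q hC hFD.measurable fun B => hm _] at h1
    have h2 := hP.stepIntegral_regIntegral_mul hA hFD (hf a) (hm Q)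
    have h3 := hP.blockIntegral_insert hA hf hU hD
    have haDQ : insert a D ∉ Q := fun h => ha' _ h (Finset.mem_insert_self a D)
    have h4 := hP.blockIntegral_insert hA hf hU haDQ
    have h5 : ∀ᵐ ξ ∂μ, ∀ B ∈ Q,
        blockIntegral lam C f (insert (insert a B) ((insert D Q).erase B)) U ξ =
          stepIntegral lam C (fun p => ∏ i ∈ D, f i p)
            (blockIntegral lam C f (insert (insert a B) (Q.erase B)) U) ξ := by
      refine (ae_ball_iff Q.countable_toSet).2 fun B hB => ?_
      have hBD : B ≠ D := fun h => hD (h ▸ hB)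
      rw [Finset.erase_insert_of_ne hBD.symm, Finset.insert_comm]
      refine hP.blockIntegral_insert hA hf hU fun h => ?_
      rcases Finset.mem_insert.1 h with h | h
      · exact haD (h ▸ Finset.mem_insert_self a B)
      · exact hD (Finset.mem_of_mem_erase h)
    have h6 : (fun p => ∏ i ∈ insert a D, f i p) = (fun p => ∏ i ∈ D, f i p) * f a := by
      funext p
      rw [Finset.prod_insert haD, Pi.mul_apply, mul_comm]
    rw [h6] at h4
    filter_upwards [h1, h2, h3, h4, h5] with ξ h1 h2 h3 h4 h5
    rw [h1, Finset.sum_insert hD, Finset.erase_insert hD]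
    simp only [Pi.add_apply, Pi.mul_apply, Finset.sum_apply] at h2 ⊢
    rw [h2, h3, h4, Finset.sum_congr rfl h5, add_assoc]

omit [DecidableEq α] in
/-- The Georgii–Nguyen–Zessin identity for a regularized integral with a factor. -/
lemma IsPapangelou.lintegral_regIntegral_mul (hP : IsPapangelou lam μ C)
    (hA : IsMaximalCover lam μ A) {g : Measure E × E → ℝ≥0∞} (hg : IsWeight g)
    (hU : Measurable U) :
    ∫⁻ ξ, (regIntegral lam C A g * U) ξ ∂μ = ∫⁻ ξ, stepIntegral lam C g U ξ ∂μ := by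
  have hw : Measurable fun p : Measure E × E => g p * U p.1 :=
    hg.measurable.mul (hU.comp measurable_fst)
  have h1 : ∀ ξ, (regIntegral lam C A g * U) ξ =
      regIntegral lam C A (fun p => g p * U p.1) ξ := fun ξ =>
    (lintegral_mul_const _ (hg.measurable.comp measurable_prodMk_left)).symm
  have h2 : Measurable fun p : Measure E × E => C p * (g (addDirac p, p.2) * U (addDirac p)) :=
    hP.measurable.mul (hw.comp (measurable_addDirac.prodMk measurable_snd))
  simp_rw [h1]
  rw [hP.lintegral_regIntegral hA hw, lintegral_prod _ h2.aemeasurable]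
  refine lintegral_congr fun ξ => lintegral_congr fun x => ?_
  rw [hg.apply_addDirac]
  ring

/-- The moment formula for regularized integrals. -/
lemma IsPapangelou.lintegral_prod_regIntegral_mul (hP : IsPapangelou lam μ C)
    (hA : IsMaximalCover lam μ A) (hf : ∀ i, IsWeight (f i)) (s : Finset α)
    (hU : Measurable U) :
    ∫⁻ ξ, (∏ i ∈ s, regIntegral lam C A (f i) ξ) * U ξ ∂μ =
      ∑ P : Finpartition s, ∫⁻ ξ, blockIntegral lam C f P.parts U ξ ∂μ := by
  have hC := hP.measurable
  induction s using Finset.induction_on generalizing U with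
  | empty =>
    have hP : ∀ P : Finpartition (∅ : Finset α), P.parts = ∅ := fun P =>
      Finpartition.parts_eq_empty_iff.2 rfl
    have : Unique (Finpartition (∅ : Finset α)) :=
      inferInstanceAs (Unique (Finpartition (⊥ : Finset α)))
    simp [hP, blockIntegral, iterIntegral]
  | insert a s ha ih =>
    have hbU : Measurable (regIntegral lam C A (f a) * U) :=
      (measurable_regIntegral hC hA.measurable (hf a).measurable).mul hU
    have hm : ∀ R : Finset (Finset α), Measurable (blockIntegral lam C f R U) :=
      fun R => measurable_blockIntegral hC hf hU
    rw [Finpartition.sum_insert ha fun Q => ∫⁻ ξ, blockIntegral lam C f Q U ξ ∂μ]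
    trans ∫⁻ ξ, (∏ i ∈ s, regIntegral lam C A (f i) ξ) *
      (regIntegral lam C A (f a) * U) ξ ∂μ
    · refine lintegral_congr fun ξ => ?_
      rw [Finset.prod_insert ha, Pi.mul_apply]
      ring
    rw [ih hbU]
    refine Finset.sum_congr rfl fun P _ => ?_
    have haP : ∀ B ∈ P.parts, a ∉ B := fun B hB => P.notMem_of_mem_parts ha hB
    have hP1 : {a} ∉ P.parts := fun h => haP _ h (Finset.mem_singleton_self a)
    rw [lintegral_congr_ae (hP.blockIntegral_regIntegral_mul hA hf hU haP),
      lintegral_congr_ae (hP.blockIntegral_insert hA hf hU hP1)]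
    simp only [Finset.prod_singleton]
    rw [← hP.lintegral_regIntegral_mul hA (hf a) (hm _),
      ← lintegral_finsetSum _ fun B _ => hm _, ← lintegral_add_right]
    · simp only [Pi.add_apply, Finset.sum_apply]
    · exact Finset.measurable_fun_sum _ fun B _ => hm _

/-- The moment formula for integrals of weights against a point process with a Papangelou
intensity. -/
lemma IsPapangelou.lintegral_prod_lintegral (hP : IsPapangelou lam μ C)
    (hf : ∀ i, IsWeight (f i)) (s : Finset α) :
    ∫⁻ ξ, ∏ i ∈ s, ∫⁻ x, f i (ξ, x) ∂ξ ∂μ =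
      ∑ P : Finpartition s, ∫⁻ ξ, blockIntegral lam C f P.parts 1 ξ ∂μ := by
  obtain ⟨A, hA⟩ := exists_isMaximalCover lam μ
  rw [hP.lintegral_prod_eq hA s fun i => (hf i).measurable,
    ← hP.lintegral_prod_regIntegral_mul hA hf s measurable_one]
  simp

end Blocks

end Papangelou

section Transformation

variable {E : Type*} [MeasurableSpace E] {c : E → Measure E → ℝ≥0∞} {lam σ : Measure E}
  {μ : Measure (Measure E)}
  {τ τinv : E → Measure E → E} {ξ : Measure E}

lemma chat_succ {k : ℕ} (x : Fin (k + 1) → E) (ξ : Measure E) :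
    chat c x ξ = c (x 0) ξ * chat c (fun l => x l.succ) (ξ + Measure.dirac (x 0)) := by
  simp only [chat, Fin.prod_univ_succ, Finset.sum_filter, Fin.sum_univ_succ]
  simp [Fin.succ_lt_succ_iff, add_assoc]

lemma measurable_chat (hc : Measurable (Function.uncurry c)) (k : ℕ) :
    Measurable fun p : (Fin k → E) × Measure E => chat c p.1 p.2 := by
  induction k with
  | zero => simp [chat]
  | succ k ih =>
    simp only [chat_succ]
    have h0 : Measurable fun p : (Fin (k + 1) → E) × Measure E => (p.1 0, p.2) := by fun_prop
    have h1 : Measurable fun p : (Fin (k + 1) → E) × Measure E =>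
        ((fun l : Fin k => p.1 l.succ), addDirac (p.2, p.1 0)) := by fun_prop
    exact (hc.comp h0).mul (ih.comp h1)

/-- The Georgii–Nguyen–Zessin identity in curried form. -/
lemma isPapangelou_of_lintegral_eq [SFinite lam] (hc : Measurable (Function.uncurry c))
    (hGNZ : ∀ w : E → Measure E → ℝ≥0∞, Measurable (Function.uncurry w) →
      ∫⁻ ξ, (∫⁻ x, w x ξ ∂ξ) ∂μ
        = ∫⁻ ξ, ∫⁻ x, w x (ξ + Measure.dirac x) * c x ξ ∂lam ∂μ) :
    IsPapangelou lam μ fun p => c p.2 p.1 where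
  measurable := hc.comp measurable_swap
  lintegral_eq w hw := by
    have hm : Measurable fun p : Measure E × E => w (addDirac p, p.2) * c p.2 p.1 :=
      (hw.comp (measurable_addDirac.prodMk measurable_snd)).mul (hc.comp measurable_swap)
    rw [hGNZ (fun x ξ => w (ξ, x)) (hw.comp measurable_swap), lintegral_prod _ hm.aemeasurable]
    rfl

/-- A shift that ignores tuples of added particles at their own positions ignores every added
particle. -/
lemma apply_add_dirac_of_exvisible
    (hexv : ∀ (k : ℕ), 1 ≤ k → ∀ (x : Fin k → E) (ξ : Measure E) (l : Fin k),
      τ (x l) (ξ + ∑ j : Fin k, Measure.dirac (x j)) = τ (x l) ξ)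
    (ξ : Measure E) (x y : E) : τ y (ξ + Measure.dirac x) = τ y ξ := by
  have h1 := hexv 1 le_rfl ![y] (ξ + Measure.dirac x) 0
  have h2 := hexv 2 one_le_two ![x, y] ξ 1
  simp only [Fin.sum_univ_succ, Fin.sum_univ_zero, add_zero, Matrix.cons_val_zero] at h1
  simp [Fin.sum_univ_succ, ← add_assoc] at h2
  rw [← h1, h2]

lemma measurable_chat_inverse (hc : Measurable (Function.uncurry c))
    (hτinv : Measurable (Function.uncurry τinv)) (k : ℕ) :
    Measurable fun p : (Fin k → E) × Measure E => chat c (fun l => τinv (p.1 l) p.2) p.2 := by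
  have h : ∀ l : Fin k, Measurable fun p : (Fin k → E) × Measure E => τinv (p.1 l) p.2 :=
    fun l => hτinv.comp (f := fun p : (Fin k → E) × Measure E => (p.1 l, p.2)) (by fun_prop)
  exact (measurable_chat hc k).comp ((measurable_pi_lambda _ h).prodMk measurable_snd)

/-- Integration over tuples by integrating the first coordinate separately. -/
lemma lintegral_pi_fin_succ [SigmaFinite σ] {k : ℕ} {g : (Fin (k + 1) → E) → ℝ≥0∞}
    (hg : Measurable g) :
    ∫⁻ y, g y ∂(Measure.pi fun _ => σ) =
      ∫⁻ x, ∫⁻ y : Fin k → E, g (Fin.cons x y) ∂(Measure.pi fun _ => σ) ∂σ := by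
  let e := MeasurableEquiv.piFinSuccAbove (fun _ : Fin (k + 1) => E) 0
  have he : MeasurePreserving e.symm _ _ :=
    (measurePreserving_piFinSuccAbove (fun _ : Fin (k + 1) => σ) 0).symm
  rw [← he.lintegral_comp hg,
    lintegral_prod (fun p => g (e.symm p)) (hg.comp e.symm.measurable).aemeasurable]
  simp [e, MeasurableEquiv.piFinSuccAbove, Fin.insertNthEquiv]

/-- Integration of tuples of added particles, in the coordinates transported by `τ`. -/
lemma iterIntegral_ofFn [SFinite lam] [SigmaFinite σ] {β : Type*} {w : β → E → ℝ≥0∞}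
    (hc : Measurable (Function.uncurry c)) (hw : ∀ B, Measurable (w B))
    (hτ : Measurable (Function.uncurry τ)) (hτinv : Measurable (Function.uncurry τinv))
    (hdirac : ∀ (ξ : Measure E) (x y : E), τinv y (ξ + Measure.dirac x) = τinv y ξ)
    (hright : ∀ ξ : Measure E, Function.RightInverse (fun x => τinv x ξ) (fun x => τ x ξ))
    (hlam : ∀ ξ : Measure E, MeasurePreserving (fun x => τinv x ξ) σ lam)
    {k : ℕ} (b : Fin k → β) (ξ : Measure E) :
    iterIntegral lam (fun p => c p.2 p.1) (fun B p => w B (τ p.2 p.1)) (List.ofFn b) 1 ξ =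
      ∫⁻ y : Fin k → E, (∏ l, w (b l) (y l)) * chat c (fun l => τinv (y l) ξ) ξ
        ∂(Measure.pi fun _ => σ) := by
  have hg : ∀ {k : ℕ} (b : Fin k → β) (ξ : Measure E), Measurable fun y : Fin k → E =>
      (∏ l, w (b l) (y l)) * chat c (fun l => τinv (y l) ξ) ξ := fun {k} b ξ =>
    (Finset.measurable_fun_prod _ fun l _ => (hw _).comp (measurable_pi_apply l)).mul
      ((measurable_chat_inverse hc hτinv k).comp measurable_prodMk_right)
  induction k generalizing ξ with
  | zero => simp [iterIntegral, chat]
  | succ k ih =>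
    have hg' : Measurable fun x => w (b 0) (τ x ξ) * c x ξ *
        iterIntegral lam (fun p => c p.2 p.1) (fun B p => w B (τ p.2 p.1))
          (List.ofFn fun l : Fin k => b l.succ) 1 (addDirac (ξ, x)) :=
      measurable_stepIntegrand_section (hc.comp measurable_swap)
        ((hw (b 0)).comp (hτ.comp measurable_swap))
        (measurable_iterIntegral (hc.comp measurable_swap)
          (fun B => (hw B).comp (hτ.comp measurable_swap)) measurable_one) ξ
    rw [lintegral_pi_fin_succ (hg b ξ), List.ofFn_succ, iterIntegral_cons, stepIntegral,
      ← (hlam ξ).lintegral_comp hg']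
    refine lintegral_congr fun x => ?_
    rw [ih, ← lintegral_const_mul _ (hg _ _), show τ (τinv x ξ) ξ = x from hright ξ x]
    refine lintegral_congr fun y => ?_
    simp only [chat_succ, Fin.prod_univ_succ, Fin.cons_zero, Fin.cons_succ, addDirac, hdirac]
    ring

lemma toList_parts_perm_ofFn_blockOf {n : ℕ} (P : Finpartition (Finset.univ : Finset (Fin n))) :
    P.parts.toList.Perm (List.ofFn (blockOf P)) := by
  refine (List.perm_ext_iff_of_nodup P.parts.nodup_toList (List.nodup_ofFn.2 ?_)).2 fun B => ?_
  · exact Subtype.val_injective.comp P.parts.equivFin.symm.injective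
  · rw [Finset.mem_toList, List.mem_ofFn]
    constructor
    · intro hB
      exact ⟨P.parts.equivFin ⟨B, hB⟩, by simp [blockOf]⟩
    · rintro ⟨l, rfl⟩
      exact (P.parts.equivFin.symm l).2

end Transformation

/-- Theorem 5.7: random transformation of a point process. If `τ` is an exvisible,
invertible random shift mapping `λ` to `σ`, then the transformed process `τ_*μ` has
correlation functions `ρ_τ(x_1,…,x_k) = ∫ ĉ((τ^{-1}(x_1,ξ),…,τ^{-1}(x_k,ξ)), ξ) μ(dξ)`
with respect to `σ`, in the sense of the moment characterization. -/
theorem random_transformation_correlation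
    {E : Type*} [MeasurableSpace E] (lam : Measure E) [SigmaFinite lam]
    (μ : Measure (Measure E)) [IsProbabilityMeasure μ]
    (c : E → Measure E → ENNReal) (hc : Measurable (Function.uncurry c))
    (hGNZ : ∀ w : E → Measure E → ENNReal, Measurable (Function.uncurry w) →
      ∫⁻ ξ, (∫⁻ x, w x ξ ∂ξ) ∂μ
        = ∫⁻ ξ, ∫⁻ x, w x (ξ + Measure.dirac x) * c x ξ ∂lam ∂μ)
    (σ : Measure E)
    (τ : E → Measure E → E) (hτ : Measurable (Function.uncurry τ))
    (hexv : ∀ (k : ℕ), 1 ≤ k → ∀ (x : Fin k → E) (ξ : Measure E) (l : Fin k),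
      τ (x l) (ξ + ∑ j : Fin k, Measure.dirac (x j)) = τ (x l) ξ)
    (τinv : E → Measure E → E) (hτinv : Measurable (Function.uncurry τinv))
    (hleft : ∀ (ξ : Measure E), Function.LeftInverse (fun x => τinv x ξ) (fun x => τ x ξ))
    (hright : ∀ (ξ : Measure E), Function.RightInverse (fun x => τinv x ξ) (fun x => τ x ξ))
    (htransport : ∀ ξ : Measure E, Measure.map (fun x => τ x ξ) lam = σ)
    (n : ℕ) (hn : 1 ≤ n)
    (v : Fin n → E → ENNReal) (hv : ∀ i, Measurable (v i)) :
    ∫⁻ ξ, ∏ i : Fin n, (∫⁻ y, v i (τ y ξ) ∂ξ) ∂μ =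
      ∑ k ∈ Finset.Icc 1 n,
        ∑ P ∈ Finset.univ.filter
            (fun P : Finpartition (Finset.univ : Finset (Fin n)) => P.parts.card = k),
          ∫⁻ x : Fin P.parts.card → E,
            (∏ l : Fin P.parts.card, ∏ i ∈ blockOf P l, v i (x l)) *
              ∫⁻ ξ, chat c (fun l => τinv (x l) ξ) ξ ∂μ
            ∂(Measure.pi fun _ => σ) := by
  have hdirac := apply_add_dirac_of_exvisible hexv
  have hdirac_inv : ∀ (ξ : Measure E) (x y : E), τinv y (ξ + Measure.dirac x) = τinv y ξ := by
    intro ξ x y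
    apply (hleft ξ).injective
    change τ (τinv y _) ξ = τ (τinv y ξ) ξ
    rw [show τ (τinv y ξ) ξ = y from hright ξ y, ← hdirac ξ x]
    exact hright (ξ + Measure.dirac x) y
  let e : Measure E → E ≃ᵐ E := fun ξ =>
    { toFun := fun x => τ x ξ
      invFun := fun x => τinv x ξ
      left_inv := hleft ξ
      right_inv := hright ξ
      measurable_toFun := hτ.comp measurable_prodMk_right
      measurable_invFun := hτinv.comp measurable_prodMk_right }
  have he : ∀ ξ, MeasurePreserving (e ξ) lam σ := fun ξ => ⟨(e ξ).measurable, htransport ξ⟩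
  have hlam : ∀ ξ : Measure E, MeasurePreserving (fun x => τinv x ξ) σ lam :=
    fun ξ => (he ξ).symm
  have : SigmaFinite σ := htransport 0 ▸ (e 0).sigmaFinite_map
  have hP := isPapangelou_of_lintegral_eq hc hGNZ
  have hf : ∀ i, IsWeight fun p : Measure E × E => v i (τ p.2 p.1) := fun i =>
    ⟨(hv i).comp (hτ.comp measurable_swap), fun ξ x y => by simp only [hdirac]⟩
  rw [Finset.sum_fiberwise_of_maps_to (s := Finset.univ) (t := Finset.Icc 1 n)
    (g := fun P : Finpartition (Finset.univ : Finset (Fin n)) => P.parts.card)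
    (f := fun P => ∫⁻ x : Fin P.parts.card → E,
      (∏ l : Fin P.parts.card, ∏ i ∈ blockOf P l, v i (x l)) *
        ∫⁻ ξ, chat c (fun l => τinv (x l) ξ) ξ ∂μ ∂(Measure.pi fun _ => σ)),
    hP.lintegral_prod_lintegral hf Finset.univ]
  · refine Finset.sum_congr rfl fun P _ => ?_
    obtain ⟨A, hA⟩ := exists_isMaximalCover lam μ
    have hw : ∀ B : Finset (Fin n), Measurable fun y => ∏ i ∈ B, v i y :=
      fun B => Finset.measurable_fun_prod B fun i _ => hv i
    have hchat := measurable_chat_inverse hc hτinv P.parts.card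
    have hprod : Measurable fun x : Fin P.parts.card → E =>
        ∏ l : Fin P.parts.card, ∏ i ∈ blockOf P l, v i (x l) :=
      Finset.measurable_fun_prod _ fun l _ => (hw _).comp (measurable_pi_apply l)
    simp only [blockIntegral]
    rw [lintegral_congr_ae (hP.iterIntegral_perm hA (fun B => IsWeight.prod B hf) measurable_one
      (toList_parts_perm_ofFn_blockOf P))]
    simp only [iterIntegral_ofFn (w := fun B y => ∏ i ∈ B, v i y) hc hw hτ hτinv hdirac_inv
      hright hlam]
    rw [lintegral_lintegral_swap]
    · refine lintegral_congr fun x => ?_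
      exact lintegral_const_mul _ (hchat.comp measurable_prodMk_left)
    · exact ((hprod.comp measurable_snd).mul (hchat.comp measurable_swap)).aemeasurable
  · intro P _
    have : Nonempty (Fin n) := ⟨⟨0, hn⟩⟩
    refine Finset.mem_Icc.2 ⟨Finset.card_pos.2 (P.parts_nonempty ?_), ?_⟩
    · exact Finset.univ_nonempty.ne_empty
    · simpa using P.card_parts_le_card
end

section
/- Suppose c(x,ξ) = 1 for all x ∈ E and ξ ∈ X (i.e., μ is a Poisson point process with intensity λ). Let σ be a measure on E and τ : E × X → E a measurable random shift such that: for every k ≥ 1, all x_1,…,x_k ∈ E, every ξ ∈ X and every l ∈ {1,…,k}, τ(x_l, ξ + δ_{x_1} + ⋯ + δ_{x_k}) = τ(x_l, ξ); for every ξ, τ(·,ξ) : E → E is a bijection with measurable inverse, jointly measurable in (x,ξ); and for every ξ, the pushforward of λ under τ(·,ξ) equals σ. Then for every n ≥ 1 and all measurable v_1,…,v_n : E → [0,∞]: ∫ ∏_{k=1}^n (∫ v_k(τ(y,ξ)) ξ(dy)) μ(dξ) = ∑_{k=1}^n ∑_{𝒫 = {P_1,…,P_k} ∈ 𝒯_n^k}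 ∏_{l=1}^k ∫_E ∏_{i ∈ P_l} v_i(x) σ(dx); that is, the transformed process τ_*μ has all the moments of a Poisson point process with intensity σ (its correlation functions with respect to σ are identically 1). -/
open MeasureTheory Finset

open ProbabilityTheory in
/-- The kernel sending a measure `ξ` to its restriction to `A` divided by `ξ A`, which is zero
when `ξ A` is infinite. -/
noncomputable def normalizedRestrict {E : Type*} [MeasurableSpace E] (A : Set E)
    (hA : MeasurableSet A) : Kernel (Measure E) E where
  toFun ξ := (ξ A)⁻¹ • ξ.restrict A
  measurable' := by
    refine Measure.measurable_of_measurable_coe _ fun s hs => ?_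
    simp only [Measure.smul_apply, smul_eq_mul, Measure.restrict_apply hs]
    exact (Measure.measurable_coe hA).inv.mul (Measure.measurable_coe (hs.inter hA))

instance {E : Type*} [MeasurableSpace E] (A : Set E) (hA : MeasurableSet A) :
    ProbabilityTheory.IsFiniteKernel (normalizedRestrict A hA) where
  exists_univ_le := ⟨1, ENNReal.one_lt_top, fun ξ => by
    simp [normalizedRestrict, ENNReal.inv_mul_le_one (ξ A)]⟩

/-- On the measures that are finite on each piece of a fixed countable measurable partition,
`ξ ↦ ∫ f(y, ξ) ξ(dy)` coincides with a measurable function. -/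
theorem exists_measurable_eq_lintegral {E : Type*} [MeasurableSpace E] {A : ℕ → Set E}
    (hA : ∀ n, MeasurableSet (A n)) (hdisj : Pairwise (Function.onFun Disjoint A))
    (hcover : ⋃ n, A n = Set.univ)
    {f : E → Measure E → ENNReal} (hf : Measurable (Function.uncurry f)) :
    ∃ Z : Measure E → ENNReal, Measurable Z ∧
      ∀ ξ : Measure E, (∀ n, ξ (A n) ≠ ⊤) → Z ξ = ∫⁻ y, f y ξ ∂ξ := by
  refine ⟨fun ξ => ∑' n, ξ (A n) * ∫⁻ y, f y ξ ∂(normalizedRestrict (A n) (hA n) ξ), ?_, ?_⟩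
  · refine Measurable.tsum fun n => (Measure.measurable_coe (hA n)).mul ?_
    exact Measurable.lintegral_kernel_prod_right (f := fun ξ y => f y ξ) (hf.comp measurable_swap)
  · intro ξ hξ
    rw [← setLIntegral_univ, ← hcover, lintegral_iUnion hA hdisj]
    refine tsum_congr fun n => ?_
    change ξ (A n) * ∫⁻ y, f y ξ ∂((ξ (A n))⁻¹ • ξ.restrict (A n)) = _
    rw [lintegral_smul_measure, smul_eq_mul]
    by_cases h0 : ξ (A n) = 0
    · rw [h0, zero_mul, setLIntegral_measure_zero _ _ h0]
    · rw [← mul_assoc, ENNReal.mul_inv_cancel h0 (hξ n), one_mul]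

/-- Summing over the partitions of `insert a s` by splitting off the block containing `a`. -/
theorem sum_finpartition_insert {ι R : Type*} [DecidableEq ι] [CommSemiring R] {a : ι}
    {s : Finset ι} (ha : a ∉ s) (m : Finset ι → R) :
    ∑ P : Finpartition (insert a s), ∏ B ∈ P.parts, m B =
      ∑ B ∈ s.powerset, m (insert a B) * ∑ Q : Finpartition (s \ B), ∏ C ∈ Q.parts, m C := by
  have hnot : ∀ {B : Finset ι} (Q : Finpartition (s \ B)) {C}, C ∈ Q.parts → a ∉ C :=
    fun Q C hC haC => ha (mem_sdiff.1 (Q.le hC haC)).1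
  have hdisj : ∀ B, Disjoint (s \ B) (insert a B) := fun B => by
    rw [disjoint_insert_right]
    exact ⟨fun h => ha (mem_sdiff.1 h).1, sdiff_disjoint⟩
  have hsup : ∀ B, B ⊆ s → (s \ B) ⊔ insert a B = insert a s := fun B hB => by
    rw [sup_eq_union, union_insert, sdiff_union_of_subset hB]
  simp only [mul_sum]
  rw [sum_sigma']
  symm
  refine sum_bij (fun p hp => p.2.extend (b := insert a p.1) (c := insert a s)
      (insert_ne_empty _ _) (hdisj _)
      (hsup _ (mem_powerset.1 (mem_sigma.1 hp).1))) (fun _ _ => mem_univ _) ?_ ?_ ?_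
  · rintro ⟨B, Q⟩ hp ⟨B', Q'⟩ hp' h
    have hB : B ⊆ s := mem_powerset.1 (mem_sigma.1 hp).1
    have hB' : B' ⊆ s := mem_powerset.1 (mem_sigma.1 hp').1
    have hparts : insert (insert a B) Q.parts = insert (insert a B') Q'.parts :=
      congrArg Finpartition.parts h
    have hBB : B = B' := by
      have h1 : insert a B ∈ insert (insert a B') Q'.parts := hparts ▸ mem_insert_self _ _
      rcases mem_insert.1 h1 with h1 | h1
      · rw [← erase_insert (fun h => ha (hB h)), h1, erase_insert (fun h => ha (hB' h))]
      · exact absurd (mem_insert_self a B) (hnot Q' h1)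
    subst hBB
    have hQ : Q = Q' := by
      ext1
      rw [← erase_insert (fun h => hnot Q h (mem_insert_self a B)), hparts,
        erase_insert (fun h => hnot Q' h (mem_insert_self a B))]
    rw [hQ]
  · intro P _
    have hmem : a ∈ P.part a := P.mem_part_self.2 (mem_insert_self a s)
    have hpart : P.part a ∈ P.parts := P.part_mem.2 (mem_insert_self a s)
    have hins : insert a ((P.part a).erase a) = P.part a := insert_erase hmem
    have hsub : (P.part a).erase a ⊆ s := fun x hx =>
      (mem_insert.1 (P.le hpart (mem_of_mem_erase hx))).resolve_left (ne_of_mem_erase hx)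
    have hrest : (P.parts.erase (P.part a)).sup id = s \ (P.part a).erase a := by
      ext x
      simp only [mem_sup, mem_erase, id, mem_sdiff]
      constructor
      · rintro ⟨C, ⟨hne, hC⟩, hx⟩
        have hxa : x ∉ P.part a := fun h => hne (P.eq_of_mem_parts hC hpart hx h)
        exact ⟨(mem_insert.1 (P.le hC hx)).resolve_left (fun h => hxa (h ▸ hmem)),
          fun h => hxa h.2⟩
      · rintro ⟨hx, hxa⟩
        obtain ⟨C, hC, hxC⟩ := P.exists_mem (mem_insert_of_mem hx : x ∈ insert a s)
        exact ⟨C, ⟨fun h => hxa ⟨fun h' => ha (h' ▸ hx), h ▸ hxC⟩, hC⟩, hxC⟩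
    refine ⟨⟨(P.part a).erase a, (P.ofSubset (erase_subset _ _) hrest)⟩, ?_, ?_⟩
    · simpa using hsub
    · ext1
      change insert (insert a ((P.part a).erase a)) (P.parts.erase (P.part a)) = P.parts
      rw [hins, insert_erase hpart]
  · rintro ⟨B, Q⟩ _
    exact (prod_insert fun h => hnot Q h (mem_insert_self a B)).symm

/-- A product over the enumerated blocks of a partition is a product over its parts. -/
theorem prod_blockOf {n : ℕ} {M : Type*} [CommMonoid M]
    (P : Finpartition (Finset.univ : Finset (Fin n))) (m : Finset (Fin n) → M) :
    ∏ l : Fin P.parts.card, m (blockOf P l) = ∏ B ∈ P.parts, m B := by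
  rw [← prod_coe_sort P.parts m]
  exact Equiv.prod_comp P.parts.equivFin.symm (fun B : P.parts => m B)

/-- Moments of a Poisson process integrated against functions `g i` that do not change when a
particle is added to the configuration and whose products have deterministic integrals `m B`. -/
theorem lintegral_prod_eq_sum_finpartition
    {E ι : Type*} [MeasurableSpace E] [DecidableEq ι] (lam : Measure E) [SigmaFinite lam]
    (μ : Measure (Measure E)) [IsProbabilityMeasure μ]
    (hGNZ : ∀ w : E → Measure E → ENNReal, Measurable (Function.uncurry w) →
      ∫⁻ ξ, (∫⁻ x, w x ξ ∂ξ) ∂μ = ∫⁻ ξ, ∫⁻ x, w x (ξ + Measure.dirac x) ∂lam ∂μ)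
    (g : ι → E → Measure E → ENNReal) (hg : ∀ i, Measurable (Function.uncurry (g i)))
    (hadd : ∀ i x y ξ, g i y (ξ + Measure.dirac x) = g i y ξ)
    (m : Finset ι → ENNReal)
    (hm : ∀ B ξ, ∫⁻ x, ∏ i ∈ B, g i x ξ ∂lam = m B) (s : Finset ι) :
    ∫⁻ ξ, ∏ i ∈ s, (∫⁻ y, g i y ξ ∂ξ) ∂μ =
      ∑ P : Finpartition s, ∏ B ∈ P.parts, m B := by
  let A : ℕ → Set E := disjointed (spanningSets lam)
  have hA : ∀ n, MeasurableSet (A n) := fun n =>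
    MeasurableSet.disjointed (measurableSet_spanningSets lam) n
  have hcover : ⋃ n, A n = Set.univ := by
    rw [iUnion_disjointed, iUnion_spanningSets]
  have hfinite : ∀ᵐ ξ ∂μ, ∀ n, ξ (A n) ≠ ⊤ := by
    rw [ae_all_iff]
    intro n
    have h := hGNZ (fun x _ => (A n).indicator 1 x)
      ((measurable_one.indicator (hA n)).comp measurable_fst)
    simp only [lintegral_indicator_one (hA n), lintegral_const, measure_univ, mul_one] at h
    have hlt : ∫⁻ ξ, ξ (A n) ∂μ ≠ ⊤ := by
      rw [h]
      exact ((measure_mono (disjointed_subset _ n)).trans_lt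
        (measure_spanningSets_lt_top lam n)).ne
    filter_upwards [ae_lt_top (Measure.measurable_coe (hA n)) hlt] with ξ hξ using hξ.ne
  have hsec : ∀ i ξ, Measurable fun x => g i x ξ := fun i ξ =>
    (hg i).comp measurable_prodMk_right
  choose Z hZ hZeq using fun i =>
    exists_measurable_eq_lintegral hA (disjoint_disjointed _) hcover (hg i)
  have hZprod : ∀ t : Finset ι, ∫⁻ ξ, ∏ i ∈ t, (∫⁻ y, g i y ξ ∂ξ) ∂μ =
      ∫⁻ ξ, ∏ i ∈ t, Z i ξ ∂μ := fun t => by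
    refine lintegral_congr_ae ?_
    filter_upwards [hfinite] with ξ hξ
    exact prod_congr rfl fun i _ => (hZeq i ξ hξ).symm
  have hZadd : ∀ ξ : Measure E, (∀ n, ξ (A n) ≠ ⊤) → ∀ i x,
      Z i (ξ + Measure.dirac x) = g i x ξ + Z i ξ := fun ξ hξ i x => by
    rw [hZeq i ξ hξ, hZeq i (ξ + Measure.dirac x) fun n => by
      rw [Measure.add_apply]; exact ENNReal.add_ne_top.2 ⟨hξ n, measure_ne_top _ _⟩]
    simp only [hadd]
    rw [lintegral_add_measure, lintegral_dirac' _ (hsec i ξ), add_comm]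
  induction s using Finset.strongInduction with
  | H s ih =>
  rcases s.eq_empty_or_nonempty with rfl | ⟨a, has⟩
  · have hunique : ∀ P : Finpartition (∅ : Finset ι), P.parts = ∅ := fun P =>
      P.parts_eq_empty_iff.2 rfl
    have hcard : Fintype.card (Finpartition (∅ : Finset ι)) = 1 :=
      Fintype.card_eq_one_iff.2 ⟨Finpartition.empty _, fun P => Finpartition.ext (hunique P)⟩
    simp [hunique, hcard]
  obtain ⟨s, ha, rfl⟩ : ∃ t, a ∉ t ∧ s = insert a t :=
    ⟨s.erase a, notMem_erase a s, (insert_erase has).symm⟩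
  rw [sum_finpartition_insert ha]
  have hw : Measurable (Function.uncurry fun x ξ => g a x ξ * ∏ i ∈ s, Z i ξ) :=
    (hg a).mul (Finset.measurable_fun_prod _ fun i _ => (hZ i).comp measurable_snd)
  calc ∫⁻ ξ, ∏ i ∈ insert a s, (∫⁻ y, g i y ξ ∂ξ) ∂μ
      = ∫⁻ ξ, ∫⁻ x, g a x ξ * ∏ i ∈ s, Z i ξ ∂ξ ∂μ := by
        refine lintegral_congr_ae ?_
        filter_upwards [hfinite] with ξ hξ
        rw [prod_insert ha, lintegral_mul_const _ (hsec a ξ)]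
        exact congrArg _ (prod_congr rfl fun i _ => (hZeq i ξ hξ).symm)
    _ = ∫⁻ ξ, ∫⁻ x, g a x (ξ + Measure.dirac x) * ∏ i ∈ s, Z i (ξ + Measure.dirac x)
          ∂lam ∂μ := hGNZ _ hw
    _ = ∫⁻ ξ, ∑ B ∈ s.powerset, m (insert a B) * ∏ i ∈ s \ B, Z i ξ ∂μ := by
        refine lintegral_congr_ae ?_
        filter_upwards [hfinite] with ξ hξ
        simp only [hadd, hZadd ξ hξ, prod_add, mul_sum]
        rw [lintegral_finsetSum _ fun B _ => (hsec a ξ).fun_mul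
          ((Finset.measurable_fun_prod B fun i _ => hsec i ξ).mul_const _)]
        refine sum_congr rfl fun B hB => ?_
        rw [← hm (insert a B) ξ, ← lintegral_mul_const _
          (Finset.measurable_fun_prod _ fun i _ => hsec i ξ)]
        refine lintegral_congr fun x => ?_
        rw [prod_insert fun h => ha (mem_powerset.1 hB h), mul_assoc]
    _ = ∑ B ∈ s.powerset, m (insert a B) *
          ∑ Q : Finpartition (s \ B), ∏ C ∈ Q.parts, m C := by
        rw [lintegral_finsetSum _ fun B _ =>
          (Finset.measurable_fun_prod _ fun i _ => hZ i).const_mul _]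
        refine sum_congr rfl fun B _ => ?_
        rw [lintegral_const_mul _ (Finset.measurable_fun_prod _ fun i _ => hZ i), ← hZprod,
          ih (s \ B) (Finset.ssubset_of_subset_of_ssubset sdiff_subset (ssubset_insert ha))]

/-- Corollary 5.8: if `μ` is a Poisson point process with intensity `λ` (Papangelou
intensity `c ≡ 1`) and `τ` is an exvisible, invertible random shift mapping `λ` to `σ`,
then the transformed process `τ_*μ` has all the moments of a Poisson point process with
intensity `σ` (its correlation functions with respect to `σ` are identically `1`). -/
theorem random_transformation_poisson
    {E : Type*} [MeasurableSpace E] (lam : Measure E) [SigmaFinite lam]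
    (μ : Measure (Measure E)) [IsProbabilityMeasure μ]
    (c : E → Measure E → ENNReal) (hc : Measurable (Function.uncurry c))
    (hc1 : ∀ x ξ, c x ξ = 1)
    (hGNZ : ∀ w : E → Measure E → ENNReal, Measurable (Function.uncurry w) →
      ∫⁻ ξ, (∫⁻ x, w x ξ ∂ξ) ∂μ
        = ∫⁻ ξ, ∫⁻ x, w x (ξ + Measure.dirac x) * c x ξ ∂lam ∂μ)
    (σ : Measure E)
    (τ : E → Measure E → E) (hτ : Measurable (Function.uncurry τ))
    (hexv : ∀ (k : ℕ), 1 ≤ k → ∀ (x : Fin k → E) (ξ : Measure E) (l : Fin k),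
      τ (x l) (ξ + ∑ j : Fin k, Measure.dirac (x j)) = τ (x l) ξ)
    (τinv : E → Measure E → E) (hτinv : Measurable (Function.uncurry τinv))
    (hleft : ∀ (ξ : Measure E), Function.LeftInverse (fun x => τinv x ξ) (fun x => τ x ξ))
    (hright : ∀ (ξ : Measure E), Function.RightInverse (fun x => τinv x ξ) (fun x => τ x ξ))
    (htransport : ∀ ξ : Measure E, Measure.map (fun x => τ x ξ) lam = σ)
    (n : ℕ) (hn : 1 ≤ n)
    (v : Fin n → E → ENNReal) (hv : ∀ i, Measurable (v i)) :
    ∫⁻ ξ, ∏ i : Fin n, (∫⁻ y, v i (τ y ξ) ∂ξ) ∂μ =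
      ∑ k ∈ Finset.Icc 1 n,
        ∑ P ∈ Finset.univ.filter
            (fun P : Finpartition (Finset.univ : Finset (Fin n)) => P.parts.card = k),
          ∏ l : Fin P.parts.card, ∫⁻ x, ∏ i ∈ blockOf P l, v i x ∂σ := by
  have hτsec : ∀ ξ, Measurable fun x => τ x ξ := fun ξ => hτ.comp measurable_prodMk_right
  have hτself : ∀ x ξ, τ x (ξ + Measure.dirac x) = τ x ξ := fun x ξ => by
    simpa using hexv 1 le_rfl (fun _ => x) ξ 0
  have hτadd : ∀ x y ξ, τ y (ξ + Measure.dirac x) = τ y ξ := fun x y ξ => by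
    rw [← hτself y (ξ + Measure.dirac x), add_assoc]
    simpa [Fin.sum_univ_two] using hexv 2 one_le_two ![x, y] ξ 1
  have hmoments := lintegral_prod_eq_sum_finpartition lam μ
    (fun w hw => by simpa only [hc1, mul_one] using hGNZ w hw)
    (fun i y ξ => v i (τ y ξ)) (fun i => (hv i).comp hτ)
    (fun i x y ξ => by rw [hτadd])
    (fun B => ∫⁻ x, ∏ i ∈ B, v i x ∂σ)
    (fun B ξ => by
      rw [← htransport ξ,
        lintegral_map (Finset.measurable_fun_prod _ fun i _ => hv i) (hτsec ξ)])
    Finset.univ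
  rw [hmoments, sum_fiberwise_of_maps_to fun P _ => mem_Icc.2 ⟨?_, ?_⟩]
  · simp only [prod_blockOf _ fun B => ∫⁻ x, ∏ i ∈ B, v i x ∂σ]
  · have : Nonempty (Fin n) := ⟨⟨0, hn⟩⟩
    exact card_pos.2 (P.parts_nonempty univ_nonempty.ne_empty)
  · simpa using P.card_parts_le_card
end
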